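/- There exists a constant C > 0, depending only on Ω, r, u and κ, such that for every f ∈ C^∞ on the closure of Ω: ‖f‖_{H^{2, 1/(2κ)+1/2}} ≤ C ( ‖L̃_1 f‖_{H^{0, 1/(2κ)-1/2}} + ‖f‖_{H^{0, 1/(2κ)-1/2}} ). -/

import Mathlib

open Set MeasureTheory

/-- Partial derivative in the `i`-th coordinate direction. -/
noncomputable def pd {n : ℕ} (i : Fin n) (f : (Fin n → ℝ) → ℝ) : (Fin n → ℝ) → ℝ :=
  fun x => fderiv ℝ f x (Pi.single i 1)

/-- Iterated partial derivative `∂^β f` for an (ordered) multi-index `β` of length `k`. -/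
noncomputable def mderiv {n k : ℕ} (β : Fin k → Fin n) (f : (Fin n → ℝ) → ℝ) :
    (Fin n → ℝ) → ℝ :=
  (List.ofFn β).foldr pd f

/-- `Ω` has a smooth boundary: it is the superlevel set of a smooth defining function whose
gradient does not vanish on the boundary. -/
def HasSmoothBoundary {n : ℕ} (Ω : Set (Fin n → ℝ)) : Prop :=
  ∃ ρ : (Fin n → ℝ) → ℝ, ContDiff ℝ (⊤ : ℕ∞) ρ ∧ Ω = {x | 0 < ρ x} ∧
    ∀ x ∈ frontier Ω, ρ x = 0 ∧ fderiv ℝ ρ x ≠ 0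

/-- The matrix field `H^{ij} = δ^{ij} - u^i u^j / (u^0)²`. -/
noncomputable def Hcoef (u : (Fin 3 → ℝ) → Fin 4 → ℝ) (i j : Fin 3)
    (x : Fin 3 → ℝ) : ℝ :=
  (if i = j then (1:ℝ) else 0) - u x i.succ * u x j.succ / (u x 0) ^ 2

/-- The degenerate elliptic operator
`L̃₁ f = (κ+1) H^{ij} (r ∂_i ∂_j f + (1/κ)(∂_i r)(∂_j f))`. -/
noncomputable def L1t (κ : ℝ) (r : (Fin 3 → ℝ) → ℝ) (u : (Fin 3 → ℝ) → Fin 4 → ℝ)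
    (f : (Fin 3 → ℝ) → ℝ) (x : Fin 3 → ℝ) : ℝ :=
  (κ + 1) * ∑ i, ∑ j, Hcoef u i j x *
    (r x * pd i (pd j f) x + (1/κ) * pd i r x * pd j f x)

/-- The weighted elliptic operator (up to sign, `L̂₁` of the paper)
`A f = -(κ+1) r^{1-1/κ} ∂_i (r^{1/κ} H^{ij} ∂_j f)`. -/
noncomputable def Aop (κ : ℝ) (r : (Fin 3 → ℝ) → ℝ) (u : (Fin 3 → ℝ) → Fin 4 → ℝ)
    (f : (Fin 3 → ℝ) → ℝ) (x : Fin 3 → ℝ) : ℝ :=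
  -(κ + 1) * r x ^ ((1:ℝ) - 1/κ) *
    ∑ i, pd i (fun y => r y ^ (1/κ) * ∑ j, Hcoef u i j y * pd j f y) x

/-- The weighted Sobolev norm with weight `r`:
`‖f‖_{H^{j,σ}}² = Σ_{|β| ≤ j} ∫_Ω r^{2σ} |∂^β f|² dx`. -/
noncomputable def rSobNorm (Ω : Set (Fin 3 → ℝ)) (r : (Fin 3 → ℝ) → ℝ) (j : ℕ) (σ : ℝ)
    (f : (Fin 3 → ℝ) → ℝ) : ℝ :=
  Real.sqrt (∑ k ∈ Finset.range (j + 1), ∑ β : Fin k → Fin 3,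
    ∫ x in Ω, r x ^ (2 * σ) * (mderiv β f x) ^ 2)

section Helpers

open Filter Topology

variable {n : ℕ} {Ω : Set (Fin n → ℝ)} {f g : (Fin n → ℝ) → ℝ} {x : Fin n → ℝ}

/-! ### Partial derivatives -/

lemma pd_congr_of_eqOn (hΩ : IsOpen Ω) (h : EqOn f g Ω) (i : Fin n) :
    EqOn (pd i f) (pd i g) Ω := fun x hx => by
  have : f =ᶠ[𝓝 x] g := h.eventuallyEq_of_mem (hΩ.mem_nhds hx)
  simp only [pd, this.fderiv_eq]

lemma pd_mul (hf : DifferentiableAt ℝ f x) (hg : DifferentiableAt ℝ g x) (i : Fin n) :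
    pd i (fun y => f y * g y) x = pd i f x * g x + f x * pd i g x := by
  simp only [pd, fderiv_fun_mul hf hg, add_apply, smul_apply, smul_eq_mul]
  ring

lemma pd_sum {ι : Type*} {s : Finset ι} {F : ι → (Fin n → ℝ) → ℝ}
    (h : ∀ j ∈ s, DifferentiableAt ℝ (F j) x) (i : Fin n) :
    pd i (fun y => ∑ j ∈ s, F j y) x = ∑ j ∈ s, pd i (F j) x := by
  simp only [pd, fderiv_fun_sum h, sum_apply]

lemma pd_comp {φ : ℝ → ℝ} {φ' : ℝ} (hφ : HasDerivAt φ φ' (f x)) (hf : DifferentiableAt ℝ f x)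
    (i : Fin n) : pd i (fun y => φ (f y)) x = φ' * pd i f x := by
  have := (hφ.comp_hasFDerivAt x hf.hasFDerivAt).fderiv
  simp only [pd]
  rw [show (fun y => φ (f y)) = φ ∘ f from rfl, this]
  simp

lemma pd_comm (hf : ContDiffAt ℝ 2 f x) (i j : Fin n) : pd i (pd j f) x = pd j (pd i f) x := by
  have hd : DifferentiableAt ℝ (fderiv ℝ f) x :=
    (hf.fderiv_right (m := 1) (by norm_num)).differentiableAt (by norm_num)
  have key : ∀ v w : Fin n → ℝ,
      fderiv ℝ (fun y => fderiv ℝ f y v) x w = fderiv ℝ (fderiv ℝ f) x w v := fun v w => by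
    rw [fderiv_clm_apply hd (differentiableAt_const v)]
    simp
  have := (hf.isSymmSndFDerivAt (by simp)).eq (Pi.single i 1) (Pi.single j 1)
  change fderiv ℝ (fun y => fderiv ℝ f y _) x _ = fderiv ℝ (fun y => fderiv ℝ f y _) x _
  rw [key, key, this]

/-! ### Functions smooth up to the boundary -/

/-- `g` agrees on `Ω` with a function that is smooth on the closure of `Ω`. -/
def SmoothUpTo (Ω : Set (Fin n → ℝ)) (g : (Fin n → ℝ) → ℝ) : Prop :=
  ∃ G : (Fin n → ℝ) → ℝ, ContDiffOn ℝ (⊤ : ℕ∞) G (closure Ω) ∧ EqOn g G Ω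

lemma ContDiffOn.smoothUpTo (h : ContDiffOn ℝ (⊤ : ℕ∞) g (closure Ω)) : SmoothUpTo Ω g :=
  ⟨g, h, fun _ _ => rfl⟩

namespace SmoothUpTo

lemma const (c : ℝ) : SmoothUpTo Ω (fun _ => c) := ContDiffOn.smoothUpTo contDiffOn_const

lemma add (hf : SmoothUpTo Ω f) (hg : SmoothUpTo Ω g) : SmoothUpTo Ω (fun x => f x + g x) := by
  obtain ⟨F, hF, hfF⟩ := hf
  obtain ⟨G, hG, hgG⟩ := hg
  exact ⟨_, hF.add hG, fun x hx => by simp [hfF hx, hgG hx]⟩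

lemma mul (hf : SmoothUpTo Ω f) (hg : SmoothUpTo Ω g) : SmoothUpTo Ω (fun x => f x * g x) := by
  obtain ⟨F, hF, hfF⟩ := hf
  obtain ⟨G, hG, hgG⟩ := hg
  exact ⟨_, hF.mul hG, fun x hx => by simp [hfF hx, hgG hx]⟩

lemma sub (hf : SmoothUpTo Ω f) (hg : SmoothUpTo Ω g) : SmoothUpTo Ω (fun x => f x - g x) := by
  obtain ⟨F, hF, hfF⟩ := hf
  obtain ⟨G, hG, hgG⟩ := hg
  exact ⟨_, hF.sub hG, fun x hx => by simp [hfF hx, hgG hx]⟩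

lemma pow (hf : SmoothUpTo Ω f) (k : ℕ) : SmoothUpTo Ω (fun x => f x ^ k) := by
  obtain ⟨F, hF, hfF⟩ := hf
  exact ⟨_, hF.pow k, fun x hx => by simp [hfF hx]⟩

lemma sum {ι : Type*} {s : Finset ι} {F : ι → (Fin n → ℝ) → ℝ}
    (h : ∀ j ∈ s, SmoothUpTo Ω (F j)) : SmoothUpTo Ω (fun x => ∑ j ∈ s, F j x) := by
  classical
  induction s using Finset.induction_on with
  | empty => simpa using const 0
  | insert a s ha ih =>
    simp only [Finset.sum_insert ha]
    exact (h a (by simp)).add (ih fun j hj => h j (by simp [hj]))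

lemma pd (hf : SmoothUpTo Ω f) (hΩ : IsOpen Ω) (hu : UniqueDiffOn ℝ (closure Ω)) (i : Fin n) :
    SmoothUpTo Ω (pd i f) := by
  obtain ⟨F, hF, hfF⟩ := hf
  refine ⟨fun x => fderivWithin ℝ F (closure Ω) x (Pi.single i 1), ?_, fun x hx => ?_⟩
  · exact (hF.fderivWithin hu (m := (⊤ : ℕ∞)) (by simp)).clm_apply contDiffOn_const
  · rw [pd_congr_of_eqOn hΩ hfF i hx]
    simp only [_root_.pd]
    rw [fderivWithin_of_mem_nhds (mem_of_superset (hΩ.mem_nhds hx) subset_closure)]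

lemma contDiffOn (hf : SmoothUpTo Ω f) : ContDiffOn ℝ (⊤ : ℕ∞) f Ω := by
  obtain ⟨F, hF, hfF⟩ := hf
  exact (hF.mono subset_closure).congr hfF

lemma contDiffAt (hf : SmoothUpTo Ω f) (hΩ : IsOpen Ω) (hx : x ∈ Ω) :
    ContDiffAt ℝ (⊤ : ℕ∞) f x :=
  hf.contDiffOn.contDiffAt (hΩ.mem_nhds hx)

lemma differentiableAt (hf : SmoothUpTo Ω f) (hΩ : IsOpen Ω) (hx : x ∈ Ω) :
    DifferentiableAt ℝ f x :=
  (hf.contDiffAt hΩ hx).differentiableAt (by simp)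

lemma exists_bound (hf : SmoothUpTo Ω f) (hb : Bornology.IsBounded Ω) :
    ∃ M > 0, ∀ x ∈ Ω, |f x| ≤ M := by
  obtain ⟨F, hF, hfF⟩ := hf
  obtain ⟨M, hM⟩ := hb.isCompact_closure.exists_bound_of_continuousOn hF.continuousOn
  refine ⟨max M 1, by positivity, fun x hx => ?_⟩
  rw [hfF hx]
  exact (hM x (subset_closure hx)).trans (le_max_left _ _)

end SmoothUpTo

/-! ### Smooth domains have the unique differentiability property -/

lemma HasSmoothBoundary.uniqueDiffOn_closure (h : HasSmoothBoundary Ω) (hΩ : IsOpen Ω) :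
    UniqueDiffOn ℝ (closure Ω) := by
  intro x hx
  by_cases hxΩ : x ∈ Ω
  · exact uniqueDiffWithinAt_of_mem_nhds (mem_of_superset (hΩ.mem_nhds hxΩ) subset_closure)
  have hfr : x ∈ frontier Ω := by rw [hΩ.frontier_eq]; exact ⟨hx, hxΩ⟩
  obtain ⟨ρ, hρ, hΩρ, hρ0⟩ := h
  obtain ⟨h0, hd⟩ := hρ0 x hfr
  refine ⟨?_, subset_closure hx⟩
  have hsub : {v | 0 < fderiv ℝ ρ x v} ⊆ tangentConeAt ℝ (closure Ω) x := by
    intro v hv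
    refine mem_tangentConeAt_of_add_smul_mem (l := 𝓝[>] (0 : ℝ)) (c := id)
      (tendsto_id'.mpr <| nhdsGT_le_nhdsNE 0) ?_
    have hder : HasDerivAt (fun t : ℝ => ρ (x + t • v)) (fderiv ℝ ρ x v) 0 := by
      have h1 : HasFDerivAt ρ (fderiv ℝ ρ x) (x + (0 : ℝ) • v) := by
        simpa using (hρ.differentiable (by simp) x).hasFDerivAt
      have h2 : HasDerivAt (fun t : ℝ => x + t • v) v 0 := by
        simpa using ((hasDerivAt_id (0 : ℝ)).smul_const v).const_add x
      exact h1.comp_hasDerivAt (0 : ℝ) h2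
    have hslope := (hasDerivAt_iff_tendsto_slope.1 hder).mono_left (nhdsGT_le_nhdsNE (0 : ℝ))
    filter_upwards [hslope.eventually (lt_mem_nhds hv), self_mem_nhdsWithin] with t ht ht0
    apply subset_closure
    rw [hΩρ]
    simp only [slope, vsub_eq_sub, sub_zero, zero_smul, add_zero, h0, smul_eq_mul] at ht
    exact (pos_iff_pos_of_mul_pos ht).1 (inv_pos.2 ht0)
  have hopen : IsOpen {v | 0 < fderiv ℝ ρ x v} :=
    isOpen_lt continuous_const (fderiv ℝ ρ x).continuous
  obtain ⟨v, hv⟩ : ∃ v, 0 < fderiv ℝ ρ x v := by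
    obtain ⟨v, hv⟩ : ∃ v, fderiv ℝ ρ x v ≠ 0 := by
      by_contra! hcon
      exact hd (ContinuousLinearMap.ext hcon)
    rcases hv.lt_or_gt with hv | hv
    · exact ⟨-v, by simpa using hv⟩
    · exact ⟨v, hv⟩
  have htop : Submodule.span ℝ (tangentConeAt ℝ (closure Ω) x) = ⊤ := by
    apply Submodule.eq_top_of_nonempty_interior'
    refine ⟨v, interior_maximal ?_ hopen hv⟩
    exact hsub.trans Submodule.subset_span
  rw [htop]
  exact dense_univ

/-! ### Boundary weights and integration by parts -/

/-- `r` is a defining function of the bounded regular domain `Ω`: smooth up to the boundary,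
positive inside, zero on the boundary, and with non-degenerate gradient there. -/
structure IsBoundaryWeight (Ω : Set (Fin n → ℝ)) (r : (Fin n → ℝ) → ℝ) : Prop where
  isOpen : IsOpen Ω
  isBounded : Bornology.IsBounded Ω
  uniqueDiffOn : UniqueDiffOn ℝ (closure Ω)
  contDiffOn : ContDiffOn ℝ (⊤ : ℕ∞) r (closure Ω)
  pos : ∀ x ∈ Ω, 0 < r x
  eq_zero : ∀ x ∈ frontier Ω, r x = 0
  exists_le : ∃ c > 0, ∀ x ∈ Ω, c ≤ r x + ∑ i, pd i r x ^ 2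

lemma isBoundaryWeight_of_fderiv_ne_zero {r : (Fin n → ℝ) → ℝ} (hΩo : IsOpen Ω)
    (hΩb : Bornology.IsBounded Ω) (hu : UniqueDiffOn ℝ (closure Ω))
    (hr : ContDiffOn ℝ (⊤ : ℕ∞) r (closure Ω)) (hrpos : ∀ x ∈ Ω, 0 < r x)
    (hr0 : ∀ x ∈ frontier Ω, r x = 0) (hrgrad : ∀ x ∈ frontier Ω, fderiv ℝ r x ≠ 0) :
    IsBoundaryWeight Ω r := by
  refine ⟨hΩo, hΩb, hu, hr, hrpos, hr0, ?_⟩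
  set D : Fin n → (Fin n → ℝ) → ℝ :=
    fun i x => fderivWithin ℝ r (closure Ω) x (Pi.single i 1) with hD
  have hDc : ∀ i, ContinuousOn (D i) (closure Ω) := fun i =>
    ((hr.fderivWithin hu (m := (⊤ : ℕ∞)) (by simp)).clm_apply contDiffOn_const).continuousOn
  have hcont : ContinuousOn (fun x => r x + ∑ i, D i x ^ 2) (closure Ω) :=
    hr.continuousOn.add (continuousOn_finsetSum _ fun i _ => (hDc i).pow 2)
  have hpos : ∀ x ∈ closure Ω, 0 < r x + ∑ i, D i x ^ 2 := by
    intro x hx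
    have hsum : 0 ≤ ∑ i, D i x ^ 2 := Finset.sum_nonneg fun i _ => sq_nonneg _
    by_cases hxΩ : x ∈ Ω
    · linarith [hrpos x hxΩ]
    have hfr : x ∈ frontier Ω := by rw [hΩo.frontier_eq]; exact ⟨hx, hxΩ⟩
    have hne := hrgrad x hfr
    have hdiff : DifferentiableAt ℝ r x := by
      by_contra hcon
      exact hne (fderiv_zero_of_not_differentiableAt hcon)
    rw [hr0 x hfr, zero_add]
    refine hsum.lt_of_ne fun hz => hne ?_
    have hall : ∀ i, D i x = 0 := fun i => by
      have := (Finset.sum_eq_zero_iff_of_nonneg fun i _ => sq_nonneg (D i x)).1 hz.symm i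
        (Finset.mem_univ i)
      exact pow_eq_zero_iff (two_ne_zero) |>.1 this
    rw [← hdiff.fderivWithin (hu x hx)]
    ext v
    rw [pi_eq_sum_univ' v]
    simp only [map_sum, map_smul, zero_apply]
    refine Finset.sum_congr rfl fun i _ => ?_
    rw [show fderivWithin ℝ r (closure Ω) x (Pi.single i 1) = 0 from hall i]
  obtain ⟨c, hc, hle⟩ := hΩb.isCompact_closure.exists_forall_le' hcont hpos
  refine ⟨c, hc, fun x hx => ?_⟩
  have := hle x (subset_closure hx)
  simp only [hD, fderivWithin_of_mem_nhds (mem_of_superset (hΩo.mem_nhds hx) subset_closure)]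
    at this
  exact this

lemma integral_pd_eq_zero {G : (Fin n → ℝ) → ℝ} (hG : ContDiff ℝ 1 G) (hc : HasCompactSupport G)
    (i : Fin n) : ∫ x, pd i G x = 0 := by
  have hi : Integrable (fun x => pd i G x) :=
    ((hG.continuous_fderiv (by norm_num)).clm_apply
      continuous_const).integrable_of_hasCompactSupport
      (hc.fderiv_apply (𝕜 := ℝ) _)
  have := integral_mul_fderiv_eq_neg_fderiv_mul_of_integrable (μ := volume) (𝕜 := ℝ)
    (f := fun _ : Fin n → ℝ => (1 : ℝ)) (g := G) (v := Pi.single i 1) (by simp)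
    (by simpa [pd] using hi) (by simpa using hG.continuous.integrable_of_hasCompactSupport hc)
    (fun x _ => differentiableAt_const _) (fun x _ => hG.differentiable (by norm_num) x)
  simpa [pd] using this

namespace IsBoundaryWeight

variable {r : (Fin n → ℝ) → ℝ}

lemma isCompact_le (h : IsBoundaryWeight Ω r) (ε : ℝ) : IsCompact {x ∈ closure Ω | ε ≤ r x} :=
  h.isBounded.isCompact_closure.of_isClosed_subset
    (h.contDiffOn.continuousOn.preimage_isClosed_of_isClosed isClosed_closure isClosed_Ici)
    (fun _ hx => hx.1)

lemma subset_of_pos (h : IsBoundaryWeight Ω r) {ε : ℝ} (hε : 0 < ε) :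
    {x ∈ closure Ω | ε ≤ r x} ⊆ Ω := by
  rintro x ⟨hx, hle⟩
  by_contra hxΩ
  have := h.eq_zero x (by rw [h.isOpen.frontier_eq]; exact ⟨hx, hxΩ⟩)
  linarith

lemma smoothUpTo (h : IsBoundaryWeight Ω r) : SmoothUpTo Ω r := h.contDiffOn.smoothUpTo

lemma pd_smoothUpTo (h : IsBoundaryWeight Ω r) (hg : SmoothUpTo Ω g) (i : Fin n) :
    SmoothUpTo Ω (pd i g) := hg.pd h.isOpen h.uniqueDiffOn i

/-- Integration by parts without boundary term for a function cut off near the boundary. -/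
lemma integral_pd_cutoff (h : IsBoundaryWeight Ω r) (hg : ContDiffOn ℝ 1 g Ω) {φ : ℝ → ℝ}
    (hφ : ContDiff ℝ 1 φ) {ε : ℝ} (hε : 0 < ε) (hφ0 : ∀ t ≤ ε, φ t = 0) (i : Fin n) :
    IntegrableOn (pd i fun x => φ (r x) * g x) Ω ∧
      ∫ x in Ω, pd i (fun x => φ (r x) * g x) x = 0 := by
  classical
  set G : (Fin n → ℝ) → ℝ := Ω.indicator fun x => φ (r x) * g x with hGdef
  set K := {x ∈ closure Ω | ε ≤ r x}
  have hKc : IsCompact K := h.isCompact_le ε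
  have hKΩ : K ⊆ Ω := h.subset_of_pos hε
  have hG0 : ∀ x ∉ K, G x = 0 := fun x hx => by
    by_cases hxΩ : x ∈ Ω
    · have : r x ≤ ε := le_of_not_ge fun hle => hx ⟨subset_closure hxΩ, hle⟩
      simp [hGdef, hφ0 _ this]
    · simp [hGdef, hxΩ]
  have hEq : EqOn G (fun x => φ (r x) * g x) Ω := fun x hx => by simp [hGdef, hx]
  have hGc : HasCompactSupport G := HasCompactSupport.intro hKc hG0
  have hGs : ContDiff ℝ 1 G := by
    rw [contDiff_iff_contDiffAt]
    intro x
    by_cases hx : x ∈ Ω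
    · have hn := h.isOpen.mem_nhds hx
      have hrx : ContDiffAt ℝ 1 r x := (h.smoothUpTo.contDiffAt h.isOpen hx).of_le (by simp)
      have := (hφ.contDiffAt.comp x hrx).mul (hg.contDiffAt hn)
      exact this.congr_of_eventuallyEq (hEq.eventuallyEq_of_mem hn)
    · have hn : Kᶜ ∈ 𝓝 x := hKc.isClosed.isOpen_compl.mem_nhds fun hxK => hx (hKΩ hxK)
      exact (contDiffAt_const (c := (0 : ℝ))).congr_of_eventuallyEq
        (eventually_of_mem hn fun y hy => hG0 y hy)
  have hpd0 : ∀ x ∉ Ω, pd i G x = 0 := fun x hx => by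
    have hn : Kᶜ ∈ 𝓝 x := hKc.isClosed.isOpen_compl.mem_nhds fun hxK => hx (hKΩ hxK)
    have : G =ᶠ[𝓝 x] fun _ => 0 := eventually_of_mem hn fun y hy => hG0 y hy
    simp [pd, this.fderiv_eq]
  have hpdEq := pd_congr_of_eqOn h.isOpen hEq i
  have hi : Integrable (fun x => pd i G x) :=
    ((hGs.continuous_fderiv (by norm_num)).clm_apply
      continuous_const).integrable_of_hasCompactSupport
      (hGc.fderiv_apply (𝕜 := ℝ) _)
  refine ⟨(integrableOn_congr_fun hpdEq h.isOpen.measurableSet).1 hi.integrableOn, ?_⟩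
  rw [← setIntegral_congr_fun h.isOpen.measurableSet hpdEq,
    setIntegral_eq_integral_of_forall_compl_eq_zero hpd0, integral_pd_eq_zero hGs hGc]

end IsBoundaryWeight

lemma exists_bound_deriv_smoothTransition :
    ∃ M > 0, ∀ s : ℝ, |deriv Real.smoothTransition (s - 1) * s| ≤ M := by
  have hcont : Continuous fun s : ℝ => deriv Real.smoothTransition (s - 1) * s :=
    (((Real.smoothTransition.contDiff (n := 1)).continuous_deriv (by norm_num)).comp
      (continuous_id.sub continuous_const)).mul continuous_id
  obtain ⟨M, hM⟩ := (isCompact_Icc (a := (1 : ℝ)) (b := 2)).exists_bound_of_continuousOn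
    hcont.continuousOn
  refine ⟨max M 1, by positivity, fun s => ?_⟩
  by_cases hs : s ∈ Icc (1 : ℝ) 2
  · exact (hM s hs).trans (le_max_left _ _)
  · have : deriv Real.smoothTransition (s - 1) = 0 := by
      rw [mem_Icc, not_and_or, not_le, not_le] at hs
      rcases hs with hs | hs
      · have : Real.smoothTransition =ᶠ[𝓝 (s - 1)] fun _ => 0 :=
          eventually_of_mem (Iio_mem_nhds (sub_neg.2 hs)) fun y hy =>
            Real.smoothTransition.zero_of_nonpos (le_of_lt hy)
        simp [this.deriv_eq]
      · have : Real.smoothTransition =ᶠ[𝓝 (s - 1)] fun _ => 1 :=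
          eventually_of_mem (Ioi_mem_nhds (a := 1) (by linarith)) fun y hy =>
            Real.smoothTransition.one_of_one_le (le_of_lt hy)
        simp [this.deriv_eq]
    simp [this]

/-- A smooth cutoff vanishing for `t ≤ ε` and equal to one for `t ≥ 2 * ε`. -/
noncomputable def cutoff (ε t : ℝ) : ℝ := Real.smoothTransition (t / ε - 1)

lemma cutoff_contDiff (ε : ℝ) : ContDiff ℝ 1 (cutoff ε) :=
  (Real.smoothTransition.contDiff (n := 1)).comp ((contDiff_id.div_const ε).sub contDiff_const)

lemma cutoff_eq_zero {ε t : ℝ} (hε : 0 < ε) (ht : t ≤ ε) : cutoff ε t = 0 :=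
  Real.smoothTransition.zero_of_nonpos (by rw [sub_nonpos, div_le_one hε]; exact ht)

lemma cutoff_eq_one {ε t : ℝ} (hε : 0 < ε) (ht : 2 * ε ≤ t) : cutoff ε t = 1 :=
  Real.smoothTransition.one_of_one_le (by
    rw [le_sub_iff_add_le, le_div_iff₀ hε]; linarith)

lemma cutoff_nonneg (ε t : ℝ) : 0 ≤ cutoff ε t := Real.smoothTransition.nonneg _

lemma cutoff_le_one (ε t : ℝ) : cutoff ε t ≤ 1 := Real.smoothTransition.le_one _

lemma hasDerivAt_cutoff (ε t : ℝ) :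
    HasDerivAt (cutoff ε) (deriv Real.smoothTransition (t / ε - 1) / ε) t := by
  have h1 : HasDerivAt (fun t : ℝ => t / ε - 1) (1 / ε) t :=
    ((hasDerivAt_id t).div_const ε).sub_const 1
  have h2 : HasDerivAt Real.smoothTransition (deriv Real.smoothTransition (t / ε - 1))
      (t / ε - 1) :=
    ((Real.smoothTransition.contDiff (n := 1)).differentiable (by norm_num) _).hasDerivAt
  have := HasDerivAt.comp t h2 h1
  rwa [mul_one_div] at this

namespace IsBoundaryWeight

variable {r : (Fin n → ℝ) → ℝ}

lemma contDiffOn_rpow (h : IsBoundaryWeight Ω r) (b : ℝ) :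
    ContDiffOn ℝ (⊤ : ℕ∞) (fun x => r x ^ b) Ω :=
  h.smoothUpTo.contDiffOn.rpow_const_of_ne fun x hx => (h.pos x hx).ne'

lemma exists_rpow_le (h : IsBoundaryWeight Ω r) {b : ℝ} (hb : 0 ≤ b) :
    ∃ M > 0, ∀ x ∈ Ω, r x ^ b ≤ M := by
  obtain ⟨R, hR, hle⟩ := h.smoothUpTo.exists_bound h.isBounded
  exact ⟨R ^ b, by positivity, fun x hx =>
    Real.rpow_le_rpow (h.pos x hx).le ((le_abs_self _).trans (hle x hx)) hb⟩

lemma pd_rpow_mul (h : IsBoundaryWeight Ω r) (hg : SmoothUpTo Ω g) (b : ℝ) (hx : x ∈ Ω)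
    (i : Fin n) :
    pd i (fun y => r y ^ b * g y) x =
      b * r x ^ (b - 1) * pd i r x * g x + r x ^ b * pd i g x := by
  have hr := h.smoothUpTo.differentiableAt h.isOpen hx
  have hrb : DifferentiableAt ℝ (fun y => r y ^ b) x :=
    hr.rpow_const (Or.inl (h.pos x hx).ne')
  rw [pd_mul hrb (hg.differentiableAt h.isOpen hx),
    pd_comp (Real.hasDerivAt_rpow_const (Or.inl (h.pos x hx).ne')) hr]

lemma pd_cutoff_mul (h : IsBoundaryWeight Ω r) (hg : SmoothUpTo Ω g) (b ε : ℝ) (hx : x ∈ Ω)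
    (i : Fin n) :
    pd i (fun y => cutoff ε (r y) * (r y ^ b * g y)) x =
      deriv Real.smoothTransition (r x / ε - 1) / ε * r x ^ b * (pd i r x * g x) +
        cutoff ε (r x) * (b * r x ^ (b - 1) * pd i r x * g x + r x ^ b * pd i g x) := by
  have hr := h.smoothUpTo.differentiableAt h.isOpen hx
  have hrb : DifferentiableAt ℝ (fun y => r y ^ b) x :=
    hr.rpow_const (Or.inl (h.pos x hx).ne')
  have hcut : DifferentiableAt ℝ (fun y => cutoff ε (r y)) x :=
    (hasDerivAt_cutoff ε (r x)).differentiableAt.comp x hr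
  rw [pd_mul hcut (hrb.fun_mul (hg.differentiableAt h.isOpen hx)),
    pd_comp (hasDerivAt_cutoff ε (r x)) hr, h.pd_rpow_mul hg b hx]
  ring

lemma integral_pd_cutoff_rpow (h : IsBoundaryWeight Ω r) (hg : SmoothUpTo Ω g) (b : ℝ) {ε : ℝ}
    (hε : 0 < ε) (i : Fin n) :
    IntegrableOn (pd i fun x => cutoff ε (r x) * (r x ^ b * g x)) Ω ∧
      ∫ x in Ω, pd i (fun x => cutoff ε (r x) * (r x ^ b * g x)) x = 0 :=
  h.integral_pd_cutoff (((h.contDiffOn_rpow b).of_le (by simp)).mul (hg.contDiffOn.of_le (by simp)))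
    (cutoff_contDiff ε) hε (fun _ ht => cutoff_eq_zero hε ht) i

lemma volume_ne_top (h : IsBoundaryWeight Ω r) : volume Ω ≠ ⊤ :=
  h.isBounded.measure_lt_top.ne

/-- The weight `r ^ (b - 1)` is integrable as soon as `b > 0`. -/
lemma integrableOn_rpow (h : IsBoundaryWeight Ω r) {b : ℝ} (hb : 0 < b) :
    IntegrableOn (fun x => r x ^ (b - 1)) Ω := by
  obtain ⟨c, hc, hlow⟩ := h.exists_le
  obtain ⟨R, hR, hRle⟩ := h.exists_rpow_le hb.le
  have hri : ∀ i, SmoothUpTo Ω (pd i r) := h.pd_smoothUpTo h.smoothUpTo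
  obtain ⟨T, hT, hTle⟩ := (SmoothUpTo.sum (s := Finset.univ) fun i _ =>
    h.pd_smoothUpTo (hri i) i).exists_bound h.isBounded
  set S : ℝ → (Fin n → ℝ) → ℝ :=
    fun ε x => ∑ i, pd i (fun y => cutoff ε (r y) * (r y ^ b * pd i r y)) x with hS
  have hSint : ∀ ε > 0, IntegrableOn (S ε) Ω := fun ε hε =>
    integrable_finsetSum _ fun i _ => (h.integral_pd_cutoff_rpow (hri i) b hε i).1
  have hS0 : ∀ ε > 0, ∫ x in Ω, S ε x = 0 := fun ε hε => by
    rw [hS]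
    simp only
    rw [integral_finsetSum _ fun i _ => (h.integral_pd_cutoff_rpow (hri i) b hε i).1]
    exact Finset.sum_eq_zero fun i _ => (h.integral_pd_cutoff_rpow (hri i) b hε i).2
  have key : ∀ ε > 0, ∀ x ∈ Ω,
      cutoff ε (r x) * (b * c * r x ^ (b - 1)) ≤ S ε x + (R * T + b * R) := by
    intro ε hε x hx
    have hSx : S ε x = deriv Real.smoothTransition (r x / ε - 1) / ε * r x ^ b
          * (∑ i, pd i r x ^ 2) + cutoff ε (r x) * (b * r x ^ (b - 1) * (∑ i, pd i r x ^ 2)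
          + r x ^ b * ∑ i, pd i (pd i r) x) := by
      simp only [hS, h.pd_cutoff_mul (hri _) b ε hx, Finset.mul_sum, mul_add,
        Finset.sum_add_distrib]
      refine congrArg₂ _ (Finset.sum_congr rfl fun i _ => by ring) (congrArg₂ _
        (Finset.sum_congr rfl fun i _ => by ring) rfl)
    have hrx := h.pos x hx
    have h1 : 0 ≤ deriv Real.smoothTransition (r x / ε - 1) / ε * r x ^ b
          * (∑ i, pd i r x ^ 2) := by
      have := Real.smoothTransition.monotone.deriv_nonneg (x := r x / ε - 1)
      have hsum : 0 ≤ ∑ i, pd i r x ^ 2 := Finset.sum_nonneg fun i _ => sq_nonneg _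
      positivity
    have hpow : r x ^ (b - 1) * r x = r x ^ b := by
      rw [← Real.rpow_add_one hrx.ne']; ring_nf
    have h2 : b * c * r x ^ (b - 1) ≤ b * r x ^ b + b * r x ^ (b - 1) * (∑ i, pd i r x ^ 2) := by
      have : b * r x ^ (b - 1) * c ≤ b * r x ^ (b - 1) * (r x + ∑ i, pd i r x ^ 2) := by
        gcongr
        exact hlow x hx
      rw [← hpow]
      linarith
    have hχ0 := cutoff_nonneg ε (r x)
    have hχ1 := cutoff_le_one ε (r x)
    have h3 : cutoff ε (r x) * (b * r x ^ b) ≤ b * R := by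
      have : b * r x ^ b ≤ b * R := by gcongr; exact hRle x hx
      exact (mul_le_of_le_one_left (by positivity) hχ1).trans this
    have h4 : -(R * T) ≤ cutoff ε (r x) * (r x ^ b * ∑ i, pd i (pd i r) x) := by
      refine neg_le_of_abs_le ?_
      rw [abs_mul, abs_mul, abs_of_nonneg hχ0, abs_of_nonneg (by positivity : 0 ≤ r x ^ b)]
      refine (mul_le_of_le_one_left (by positivity) hχ1).trans ?_
      exact mul_le_mul (hRle x hx) (hTle x hx) (abs_nonneg _) hR.le
    have h5 := mul_le_mul_of_nonneg_left h2 hχ0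
    rw [hSx]
    linarith
  have hcont : ContinuousOn (fun x => b * c * r x ^ (b - 1)) Ω :=
    ((h.contDiffOn_rpow (b - 1)).continuousOn).const_mul _ |>.congr fun _ _ => rfl
  set ε : ℕ → ℝ := fun k => 1 / (k + 1) with hεdef
  have hε : ∀ k, 0 < ε k := fun k => by positivity
  set A : ℕ → Set (Fin n → ℝ) := fun k => {x ∈ closure Ω | 2 * ε k ≤ r x} with hA
  have hAΩ : ∀ k, A k ⊆ Ω := fun k => h.subset_of_pos (by have := hε k; positivity)
  have hAc : ∀ k, IsCompact (A k) := fun k => h.isCompact_le _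
  have hcover : AECover (volume.restrict Ω) atTop A := by
    refine ⟨?_, fun k => (hAc k).isClosed.measurableSet⟩
    filter_upwards [ae_restrict_mem h.isOpen.measurableSet] with x hx
    have hlim : Tendsto (fun k => 2 * ε k) atTop (𝓝 0) := by
      simpa [hεdef] using tendsto_one_div_add_atTop_nhds_zero_nat.const_mul (2 : ℝ)
    filter_upwards [hlim.eventually (gt_mem_nhds (h.pos x hx))] with k hk
    exact ⟨subset_closure hx, hk.le⟩
  have hnn : ∀ x ∈ Ω, 0 ≤ b * c * r x ^ (b - 1) := fun x hx => by
    have := h.pos x hx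
    positivity
  have hrestr : ∀ k, (volume.restrict Ω).restrict (A k) = volume.restrict (A k) := fun k =>
    Measure.restrict_restrict_of_subset (hAΩ k)
  have hAint : ∀ k, IntegrableOn (fun x => b * c * r x ^ (b - 1)) (A k) := fun k =>
    (hcont.mono (hAΩ k)).integrableOn_compact (hAc k)
  have hfinal : Integrable (fun x => b * c * r x ^ (b - 1)) (volume.restrict Ω) := by
    refine hcover.integrable_of_integral_bounded_of_nonneg_ae
      (∫ x in Ω, (R * T + b * R)) (fun k => ?_) ?_ (Eventually.of_forall fun k => ?_)
    · rw [IntegrableOn, hrestr]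
      exact hAint k
    · filter_upwards [ae_restrict_mem h.isOpen.measurableSet] with x hx using hnn x hx
    · rw [hrestr]
      have hconst : IntegrableOn (fun _ : Fin n → ℝ => R * T + b * R) Ω :=
        integrableOn_const h.volume_ne_top
      have hSc : IntegrableOn (fun x => S (ε k) x + (R * T + b * R)) Ω :=
        (hSint _ (hε k)).add hconst
      calc ∫ x in A k, b * c * r x ^ (b - 1)
          ≤ ∫ x in A k, (S (ε k) x + (R * T + b * R)) := by
            refine setIntegral_mono_on (hAint k) (hSc.mono_set (hAΩ k))
              (hAc k).isClosed.measurableSet fun x hx => ?_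
            have := key _ (hε k) x (hAΩ k hx)
            rwa [cutoff_eq_one (hε k) hx.2, one_mul] at this
        _ ≤ ∫ x in Ω, (S (ε k) x + (R * T + b * R)) := by
            refine setIntegral_mono_set hSc ?_ (hAΩ k).eventuallyLE
            filter_upwards [ae_restrict_mem h.isOpen.measurableSet] with x hx
            exact (mul_nonneg (cutoff_nonneg _ _) (hnn x hx)).trans (key _ (hε k) x hx)
        _ = ∫ x in Ω, (R * T + b * R) := by
            rw [integral_add (hSint _ (hε k)) hconst, hS0 _ (hε k), zero_add]
  have hbc : b * c ≠ 0 := by positivity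
  refine (hfinal.const_mul (b * c)⁻¹).congr (ae_of_all _ fun x => ?_)
  exact inv_mul_cancel_left₀ hbc _

lemma integrableOn_rpow_mul (h : IsBoundaryWeight Ω r) {b : ℝ} (hb : 0 < b)
    (hg : SmoothUpTo Ω g) : IntegrableOn (fun x => r x ^ (b - 1) * g x) Ω := by
  obtain ⟨M, -, hM⟩ := hg.exists_bound h.isBounded
  refine (h.integrableOn_rpow hb).mul_bdd (c := M)
    (hg.contDiffOn.continuousOn.aestronglyMeasurable h.isOpen.measurableSet) ?_
  filter_upwards [ae_restrict_mem h.isOpen.measurableSet] with x hx using hM x hx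

/-- Weighted integration by parts: the boundary terms vanish when `b > 0`. -/
lemma integral_rpow_pd (h : IsBoundaryWeight Ω r) {b : ℝ} (hb : 0 < b) (hg : SmoothUpTo Ω g)
    (i : Fin n) :
    ∫ x in Ω, r x ^ (b - 1) * (r x * pd i g x + b * pd i r x * g x) = 0 := by
  obtain ⟨M, hM, hψ⟩ := exists_bound_deriv_smoothTransition
  have hri := h.pd_smoothUpTo h.smoothUpTo i
  have hgi := h.pd_smoothUpTo hg i
  have hmain : SmoothUpTo Ω (fun x => r x * pd i g x + b * pd i r x * g x) :=
    (h.smoothUpTo.mul hgi).add (((SmoothUpTo.const b).mul hri).mul hg)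
  obtain ⟨B₁, hB₁, hle₁⟩ := (hri.mul hg).exists_bound h.isBounded
  obtain ⟨B₂, hB₂, hle₂⟩ := hmain.exists_bound h.isBounded
  have hpow : ∀ x ∈ Ω, r x ^ (b - 1) * r x = r x ^ b := fun x hx => by
    rw [← Real.rpow_add_one (h.pos x hx).ne']; ring_nf
  set ε : ℕ → ℝ := fun k => 1 / (k + 1) with hεdef
  have hε : ∀ k, 0 < ε k := fun k => by positivity
  set F : ℕ → (Fin n → ℝ) → ℝ :=
    fun k => pd i (fun y => cutoff (ε k) (r y) * (r y ^ b * g y)) with hF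
  have hFx : ∀ k, ∀ x ∈ Ω, F k x = r x ^ (b - 1) *
      (deriv Real.smoothTransition (r x / ε k - 1) * (r x / ε k) * (pd i r x * g x)
        + cutoff (ε k) (r x) * (r x * pd i g x + b * pd i r x * g x)) := fun k x hx => by
    simp only [hF]
    rw [h.pd_cutoff_mul hg b _ hx, ← hpow x hx]
    field_simp
    ring
  have hlim : Tendsto (fun k => ∫ x in Ω, F k x) atTop
      (𝓝 (∫ x in Ω, r x ^ (b - 1) * (r x * pd i g x + b * pd i r x * g x))) := by
    refine tendsto_integral_of_dominated_convergence
      (fun x => r x ^ (b - 1) * (M * B₁ + B₂))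
      (fun k => (h.integral_pd_cutoff_rpow hg b (hε k) i).1.aestronglyMeasurable)
      ((h.integrableOn_rpow hb).mul_const _) (fun k => ?_) ?_
    · filter_upwards [ae_restrict_mem h.isOpen.measurableSet] with x hx
      have hrx := h.pos x hx
      rw [hFx k x hx, Real.norm_eq_abs, abs_mul, abs_of_nonneg (by positivity : 0 ≤ r x ^ (b - 1))]
      gcongr
      refine (abs_add_le _ _).trans (add_le_add ?_ ?_)
      · rw [abs_mul]
        exact mul_le_mul (hψ _) (hle₁ x hx) (abs_nonneg _) hM.le
      · rw [abs_mul, abs_of_nonneg (cutoff_nonneg _ _)]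
        exact (mul_le_of_le_one_left (abs_nonneg _) (cutoff_le_one _ _)).trans (hle₂ x hx)
    · filter_upwards [ae_restrict_mem h.isOpen.measurableSet] with x hx
      have hlim : Tendsto (fun k => 2 * ε k) atTop (𝓝 0) := by
        simpa [hεdef] using tendsto_one_div_add_atTop_nhds_zero_nat.const_mul (2 : ℝ)
      refine tendsto_const_nhds.congr' ?_
      filter_upwards [hlim.eventually (gt_mem_nhds (h.pos x hx))] with k hk
      have hεk := hε k
      have hone : (2 : ℝ) < r x / ε k := by rwa [lt_div_iff₀ hεk]
      have hd : deriv Real.smoothTransition (r x / ε k - 1) = 0 := by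
        have : Real.smoothTransition =ᶠ[𝓝 (r x / ε k - 1)] fun _ => 1 :=
          eventually_of_mem (Ioi_mem_nhds (a := 1) (by linarith)) fun y hy =>
            Real.smoothTransition.one_of_one_le (le_of_lt hy)
        simp [this.deriv_eq]
      rw [hFx k x hx, hd, cutoff_eq_one hεk hk.le]
      ring
  have hzero : ∀ k, ∫ x in Ω, F k x = 0 := fun k => (h.integral_pd_cutoff_rpow hg b (hε k) i).2
  simp only [hzero] at hlim
  exact tendsto_nhds_unique hlim tendsto_const_nhds

end IsBoundaryWeight

/-! ### Pointwise algebra -/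

lemma energy_identity (H F dH : Fin 3 → Fin 3 → ℝ) (p q : Fin 3 → ℝ) (v ρ a : ℝ) :
    ρ * ∑ i, ∑ j, (p i * (H i j * p j) + v * (dH i j * p j + H i j * F i j)) +
        a * ∑ i, q i * ∑ j, v * (H i j * p j) =
      v * (∑ i, ∑ j, H i j * (ρ * F i j + a * q i * p j)) +
        ρ * (∑ i, ∑ j, H i j * (p i * p j)) + ρ * ∑ j, v * (∑ i, dH i j) * p j := by
  simp only [Fin.sum_univ_three]
  ring

lemma energy_inequality (Hpp p₂ θ M R v ℓ ρ : ℝ) (p B : Fin 3 → ℝ) (hp₂ : p₂ = ∑ j, p j ^ 2)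
    (hθ : 0 < θ) (hρ : 0 < ρ) (hρR : ρ ≤ R) (hH : θ * p₂ ≤ Hpp) (hB : ∑ j, B j ^ 2 ≤ M) :
    θ / 2 * (ρ * p₂) ≤ (1 / 2 + R * M / (2 * θ)) * (ℓ ^ 2 + v ^ 2) +
      (v * ℓ + ρ * Hpp + ρ * ∑ j, v * B j * p j) := by
  have h1 : ∑ j, -(v * B j * p j) ≤ ∑ j, (θ / 2 * p j ^ 2 + v ^ 2 / (2 * θ) * B j ^ 2) := by
    refine Finset.sum_le_sum fun j _ => ?_
    have : θ / 2 * p j ^ 2 + v ^ 2 / (2 * θ) * B j ^ 2 + v * B j * p j =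
        (θ * p j + v * B j) ^ 2 / (2 * θ) := by field_simp; ring
    have h0 : 0 ≤ (θ * p j + v * B j) ^ 2 / (2 * θ) := by positivity
    linarith
  rw [Finset.sum_neg_distrib, Finset.sum_add_distrib, ← Finset.mul_sum, ← Finset.mul_sum,
    ← hp₂] at h1
  have hB0 : 0 ≤ ∑ j, B j ^ 2 := Finset.sum_nonneg fun _ _ => sq_nonneg _
  have h2 : ρ * (v ^ 2 / (2 * θ) * ∑ j, B j ^ 2) ≤ R * (v ^ 2 / (2 * θ) * M) := by
    gcongr
    exact hρ.le.trans hρR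
  have h3 := mul_le_mul_of_nonneg_left h1 hρ.le
  have h4 := mul_le_mul_of_nonneg_left hH hρ.le
  have h5 : 0 ≤ R * M / (2 * θ) * ℓ ^ 2 := by
    have := hρ.le.trans hρR
    have := hB0.trans hB
    positivity
  have h6 : R * M / (2 * θ) * v ^ 2 = R * (v ^ 2 / (2 * θ) * M) := by ring
  nlinarith [sq_nonneg (v + ℓ)]

lemma rellich_identity (H F : Fin 3 → Fin 3 → ℝ) (hH : ∀ i j, H i j = H j i)
    (hF : ∀ i j, F i j = F j i) (E : Fin 3 → Fin 3 → Fin 3 → ℝ) (N p q : Fin 3 → ℝ)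
    (hN : ∀ k, N k = ∑ l, H k l * q l) (ρ a : ℝ) :
    ρ * ∑ i, ∑ j, ∑ k, (E i j k * (p j * p k) +
          (H i j * N k - 1 / 2 * (H j k * N i)) * (F i j * p k + p j * F i k)) +
        a * ∑ i, q i * ∑ j, ∑ k, (H i j * N k - 1 / 2 * (H j k * N i)) * (p j * p k) =
      (∑ k, N k * p k) * (∑ i, ∑ j, H i j * (ρ * F i j + a * q i * p j)) -
        a / 2 * ((∑ k, N k * q k) * ∑ i, ∑ j, H i j * (p i * p j)) +
        ρ * ∑ j, ∑ k, (∑ i, E i j k) * (p j * p k) := by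
  have hNp : ∑ i, ∑ j, H i j * (ρ * F i j + a * q i * p j) =
      ρ * (∑ i, ∑ j, H i j * F i j) + a * ∑ k, N k * p k := by
    simp only [hN, Fin.sum_univ_three]
    rw [hH 1 0, hH 2 0, hH 2 1]
    ring
  have hq : ∑ i, q i * ∑ j, ∑ k, (H i j * N k - 1 / 2 * (H j k * N i)) * (p j * p k) =
      (∑ k, N k * p k) * (∑ k, N k * p k) -
        1 / 2 * ((∑ k, N k * q k) * ∑ i, ∑ j, H i j * (p i * p j)) := by
    have hNq : ∑ k, N k * p k = ∑ i, ∑ j, q i * (H i j * p j) := by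
      simp only [hN, Fin.sum_univ_three]
      rw [hH 1 0, hH 2 0, hH 2 1]
      ring
    nth_rewrite 1 [hNq]
    simp only [Fin.sum_univ_three]
    ring
  rw [hNp, hq]
  clear hNp hN hq
  simp only [Fin.sum_univ_three]
  rw [hH 1 0, hH 2 0, hH 2 1, hF 1 0, hF 2 0, hF 2 1]
  ring

lemma sum_mul_mul_le (Q : Fin 3 → Fin 3 → ℝ) (p : Fin 3 → ℝ) :
    ∑ j, ∑ k, Q j k * (p j * p k) ≤
      (∑ j, ∑ k, Q j k ^ 2 + 3) * (∑ j, p j ^ 2) := by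
  have h : ∀ j k, Q j k * (p j * p k) ≤ Q j k ^ 2 * (∑ j, p j ^ 2) + p k ^ 2 := fun j k => by
    have h1 : p j ^ 2 ≤ ∑ j, p j ^ 2 :=
      Finset.single_le_sum (f := fun j => p j ^ 2) (fun _ _ => sq_nonneg _) (Finset.mem_univ j)
    have h2 := mul_le_mul_of_nonneg_left h1 (sq_nonneg (Q j k))
    nlinarith [sq_nonneg (Q j k * p j - p k), sq_nonneg (Q j k * p j), sq_nonneg (p k)]
  refine (Finset.sum_le_sum fun j _ => Finset.sum_le_sum fun k _ => h j k).trans (le_of_eq ?_)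
  simp only [Finset.sum_add_distrib, ← Finset.sum_mul, Finset.sum_const, Finset.card_univ,
    Fintype.card_fin, nsmul_eq_mul]
  push_cast
  ring

lemma rellich_inequality (a θ c M₁ M₂ ρ ℓ Np Nq Hpp Qpp p₂ q₂ δ : ℝ) (ha : 0 < a) (hθ : 0 < θ)
    (hδ : 0 < δ) (hδM : δ * M₁ ≤ a / 2 * θ ^ 2 * c) (hρ : 0 < ρ)
    (hp₂ : 0 ≤ p₂) (hq₂ : 0 ≤ q₂) (hc : c ≤ ρ + q₂) (hNq : θ * q₂ ≤ Nq) (hHpp : θ * p₂ ≤ Hpp)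
    (hNp : Np ^ 2 ≤ M₁ * p₂) (hQ : Qpp ≤ M₂ * p₂) (hM₂ : 0 ≤ M₂) :
    a / 4 * θ ^ 2 * c * p₂ ≤
      (a / 2 * θ ^ 2 + M₂ + 1 / (2 * δ)) * (ℓ ^ 2 + ρ * p₂) +
        (-1) * (Np * ℓ - a / 2 * (Nq * Hpp) + ρ * Qpp) := by
  have h1 : θ * q₂ * (θ * p₂) ≤ Nq * Hpp :=
    mul_le_mul hNq hHpp (by positivity) ((by positivity : 0 ≤ θ * q₂).trans hNq)
  have h2 : Np * ℓ ≤ δ / 2 * Np ^ 2 + 1 / (2 * δ) * ℓ ^ 2 := by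
    have : δ / 2 * Np ^ 2 + 1 / (2 * δ) * ℓ ^ 2 - Np * ℓ = (δ * Np - ℓ) ^ 2 / (2 * δ) := by
      field_simp; ring
    have h0 : 0 ≤ (δ * Np - ℓ) ^ 2 / (2 * δ) := by positivity
    linarith
  have h3 : δ / 2 * Np ^ 2 ≤ a / 4 * θ ^ 2 * c * p₂ := by
    have e1 : δ / 2 * Np ^ 2 ≤ δ / 2 * (M₁ * p₂) := by gcongr
    have e2 := mul_le_mul_of_nonneg_right hδM hp₂
    linarith
  have h4 : ρ * Qpp ≤ M₂ * (ρ * p₂) := by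
    have := mul_le_mul_of_nonneg_left hQ hρ.le
    linarith
  have h5 : a / 2 * θ ^ 2 * p₂ * c ≤ a / 2 * θ ^ 2 * p₂ * (ρ + q₂) := by gcongr
  have h6 := mul_le_mul_of_nonneg_left h1 (by positivity : 0 ≤ a / 2)
  have h7 : 0 ≤ (a / 2 * θ ^ 2 + M₂) * ℓ ^ 2 := by positivity
  have h8 : 0 ≤ 1 / (2 * δ) * (ρ * p₂) := by positivity
  linarith

lemma hessian_identity (H F : Fin 3 → Fin 3 → ℝ)
    (E : Fin 3 → Fin 3 → Fin 3 → Fin 3 → ℝ) (T : Fin 3 → Fin 3 → Fin 3 → ℝ)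
    (hT : ∀ i j k, T k i j = T j i k) (p q : Fin 3 → ℝ) (ρ b : ℝ) :
    ρ * (ρ * ∑ k, ∑ i, ∑ j, ∑ l, (E k i j l * (F i j * p l) +
          (H i j * H k l - H i k * H j l) * (T k i j * p l + F i j * F k l)) +
        b * ∑ k, q k * ∑ i, ∑ j, ∑ l, (H i j * H k l - H i k * H j l) * (F i j * p l)) =
      (ρ * ∑ i, ∑ j, H i j * F i j) ^ 2 -
        ρ ^ 2 * (∑ i, ∑ j, ∑ k, ∑ l, H i k * H j l * (F i j * F k l)) +
        ∑ i, ∑ j, ∑ l, ρ * (∑ k, (ρ * E k i j l +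
          b * (q k * (H i j * H k l - H i k * H j l)))) * F i j * p l := by
  have hT0 : ∑ k, ∑ i, ∑ j, ∑ l, (H i j * H k l - H i k * H j l) * (T k i j * p l) = 0 := by
    have hswap : ∑ k, ∑ i, ∑ j, ∑ l, (H i j * H k l - H i k * H j l) * (T k i j * p l) =
        ∑ k, ∑ i, ∑ j, ∑ l, (H i k * H j l - H i j * H k l) * (T k i j * p l) := by
      rw [Finset.sum_comm]
      conv_rhs => rw [Finset.sum_comm]
      refine Finset.sum_congr rfl fun i _ => ?_
      rw [Finset.sum_comm]
      refine Finset.sum_congr rfl fun k _ => Finset.sum_congr rfl fun j _ =>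
        Finset.sum_congr rfl fun l _ => ?_
      rw [hT i k j]
    have hneg : ∑ k, ∑ i, ∑ j, ∑ l, (H i k * H j l - H i j * H k l) * (T k i j * p l) =
        -∑ k, ∑ i, ∑ j, ∑ l, (H i j * H k l - H i k * H j l) * (T k i j * p l) := by
      simp only [← Finset.sum_neg_distrib]
      refine Finset.sum_congr rfl fun i _ => Finset.sum_congr rfl fun k _ =>
        Finset.sum_congr rfl fun j _ => Finset.sum_congr rfl fun l _ => ?_
      ring
    linarith
  have hFF : ∑ k, ∑ i, ∑ j, ∑ l, (H i j * H k l - H i k * H j l) * (F i j * F k l) =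
      (∑ i, ∑ j, H i j * F i j) ^ 2 -
        ∑ i, ∑ j, ∑ k, ∑ l, H i k * H j l * (F i j * F k l) := by
    have e1 : ∑ k, ∑ i, ∑ j, ∑ l, H i j * H k l * (F i j * F k l) =
        (∑ i, ∑ j, H i j * F i j) ^ 2 := by
      rw [sq, Finset.sum_mul_sum, Finset.sum_comm]
      refine Finset.sum_congr rfl fun i _ => Finset.sum_congr rfl fun k _ => ?_
      rw [Finset.sum_mul_sum]
      exact Finset.sum_congr rfl fun j _ => Finset.sum_congr rfl fun l _ => by ring
    have e2 : ∑ k, ∑ i, ∑ j, ∑ l, H i k * H j l * (F i j * F k l) =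
        ∑ i, ∑ j, ∑ k, ∑ l, H i k * H j l * (F i j * F k l) := by
      rw [Finset.sum_comm]
      exact Finset.sum_congr rfl fun i _ => Finset.sum_comm
    rw [← e1, ← e2]
    simp only [sub_mul, Finset.sum_sub_distrib]
  have hA : ∑ i, ∑ j, ∑ l, ρ * (∑ k, (ρ * E k i j l +
          b * (q k * (H i j * H k l - H i k * H j l)))) * F i j * p l =
      ρ * (ρ * ∑ k, ∑ i, ∑ j, ∑ l, E k i j l * (F i j * p l)) +
      ρ * (b * ∑ k, q k * ∑ i, ∑ j, ∑ l, (H i j * H k l - H i k * H j l) * (F i j * p l)) := by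
    simp only [Finset.mul_sum, Finset.sum_mul, ← Finset.sum_add_distrib]
    symm
    rw [Finset.sum_comm]
    refine Finset.sum_congr rfl fun i _ => ?_
    rw [Finset.sum_comm]
    refine Finset.sum_congr rfl fun j _ => ?_
    rw [Finset.sum_comm]
    refine Finset.sum_congr rfl fun l _ => Finset.sum_congr rfl fun k _ => ?_
    ring
  rw [hA]
  have hsplit : ∑ k, ∑ i, ∑ j, ∑ l, (E k i j l * (F i j * p l) +
          (H i j * H k l - H i k * H j l) * (T k i j * p l + F i j * F k l)) =
      ∑ k, ∑ i, ∑ j, ∑ l, E k i j l * (F i j * p l) +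
      (∑ k, ∑ i, ∑ j, ∑ l, (H i j * H k l - H i k * H j l) * (T k i j * p l) +
      ∑ k, ∑ i, ∑ j, ∑ l, (H i j * H k l - H i k * H j l) * (F i j * F k l)) := by
    simp only [← Finset.sum_add_distrib]
    refine Finset.sum_congr rfl fun i _ => Finset.sum_congr rfl fun k _ =>
      Finset.sum_congr rfl fun j _ => Finset.sum_congr rfl fun l _ => ?_
    ring
  rw [hsplit, hT0, hFF]
  ring

lemma hessian_inequality (θ M₁ M₃ a ρ ℓ HF Np tr p₂ F₂ : ℝ) (A : Fin 3 → Fin 3 → Fin 3 → ℝ)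
    (F : Fin 3 → Fin 3 → ℝ) (p : Fin 3 → ℝ) (hp₂ : p₂ = ∑ j, p j ^ 2)
    (hF₂ : F₂ = ∑ i, ∑ j, F i j ^ 2) (hθ : 0 < θ) (htr : θ * F₂ ≤ tr)
    (hℓ : ℓ = ρ * HF + a * Np) (hNp : Np ^ 2 ≤ M₁ * p₂) (hM₁ : 0 ≤ M₁)
    (hA : ∑ i, ∑ j, ∑ l, A i j l ^ 2 ≤ M₃) :
    θ / 2 * (ρ ^ 2 * F₂) ≤ (2 + 2 * a ^ 2 * M₁ + 3 * M₃ / (2 * θ)) * (ℓ ^ 2 + p₂) +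
      (-1) * ((ρ * HF) ^ 2 - ρ ^ 2 * tr + ∑ i, ∑ j, ∑ l, ρ * A i j l * F i j * p l) := by
  have hp0 : 0 ≤ p₂ := hp₂ ▸ Finset.sum_nonneg fun _ _ => sq_nonneg _
  have hA0 : 0 ≤ M₃ := (Finset.sum_nonneg fun _ _ => Finset.sum_nonneg fun _ _ =>
    Finset.sum_nonneg fun _ _ => sq_nonneg _).trans hA
  have h1 : ∑ i, ∑ j, ∑ l, ρ * A i j l * F i j * p l ≤
      ∑ i, ∑ j, ∑ _l : Fin 3, (θ / 6 * (ρ ^ 2 * F i j ^ 2)) +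
        ∑ i, ∑ j, ∑ l, 3 / (2 * θ) * p₂ * A i j l ^ 2 := by
    simp only [← Finset.sum_add_distrib]
    refine Finset.sum_le_sum fun i _ => Finset.sum_le_sum fun j _ =>
      Finset.sum_le_sum fun l _ => ?_
    have e1 : p l ^ 2 ≤ p₂ := hp₂ ▸
      Finset.single_le_sum (f := fun j => p j ^ 2) (fun _ _ => sq_nonneg _) (Finset.mem_univ l)
    have e2 : 3 / (2 * θ) * p l ^ 2 * A i j l ^ 2 ≤ 3 / (2 * θ) * p₂ * A i j l ^ 2 := by gcongr
    have e3 : θ / 6 * (ρ ^ 2 * F i j ^ 2) + 3 / (2 * θ) * p l ^ 2 * A i j l ^ 2 -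
        ρ * A i j l * F i j * p l = (θ * (ρ * F i j) - 3 * (p l * A i j l)) ^ 2 / (6 * θ) := by
      field_simp; ring
    have e4 : 0 ≤ (θ * (ρ * F i j) - 3 * (p l * A i j l)) ^ 2 / (6 * θ) := by positivity
    linarith
  have h2 : ∑ i, ∑ j, ∑ _l : Fin 3, (θ / 6 * (ρ ^ 2 * F i j ^ 2)) = θ / 2 * (ρ ^ 2 * F₂) := by
    simp only [Finset.sum_const, Finset.card_univ, Fintype.card_fin, hF₂, Finset.mul_sum,
      nsmul_eq_mul]
    refine Finset.sum_congr rfl fun i _ => Finset.sum_congr rfl fun j _ => ?_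
    push_cast
    ring
  have h3 : ∑ i, ∑ j, ∑ l, 3 / (2 * θ) * p₂ * A i j l ^ 2 ≤ 3 / (2 * θ) * p₂ * M₃ := by
    simp only [← Finset.mul_sum]
    gcongr
  have h4 : (ρ * HF) ^ 2 ≤ 2 * ℓ ^ 2 + 2 * a ^ 2 * (M₁ * p₂) := by
    have e1 := mul_le_mul_of_nonneg_left hNp (by positivity : 0 ≤ 2 * a ^ 2)
    have e2 : ρ * HF = ℓ - a * Np := by rw [hℓ]; ring
    rw [e2]
    nlinarith [sq_nonneg (ℓ + a * Np)]
  have h5 := mul_le_mul_of_nonneg_left htr (sq_nonneg ρ)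
  have h6 : 0 ≤ (2 * a ^ 2 * M₁ + 3 * M₃ / (2 * θ)) * ℓ ^ 2 := by positivity
  have h7 : 3 * M₃ / (2 * θ) * p₂ = 3 / (2 * θ) * p₂ * M₃ := by ring
  linarith

/-! ### The weighted integral -/

/-- The integral over `Ω` against the weight `r ^ (a - 1)`. -/
noncomputable def wint (Ω : Set (Fin n → ℝ)) (r : (Fin n → ℝ) → ℝ) (a : ℝ)
    (g : (Fin n → ℝ) → ℝ) : ℝ :=
  ∫ x in Ω, r x ^ (a - 1) * g x

lemma SmoothUpTo.pd_fun_mul (hf : SmoothUpTo Ω f) (hg : SmoothUpTo Ω g) (hΩ : IsOpen Ω)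
    (hx : x ∈ Ω) (i : Fin n) :
    _root_.pd i (fun y => f y * g y) x = _root_.pd i f x * g x + f x * _root_.pd i g x :=
  pd_mul (hf.differentiableAt hΩ hx) (hg.differentiableAt hΩ hx) i

lemma SmoothUpTo.pd_fun_sum {ι : Type*} {s : Finset ι} {F : ι → (Fin n → ℝ) → ℝ}
    (h : ∀ j, SmoothUpTo Ω (F j)) (hΩ : IsOpen Ω) (hx : x ∈ Ω) (i : Fin n) :
    _root_.pd i (fun y => ∑ j ∈ s, F j y) x = ∑ j ∈ s, _root_.pd i (F j) x :=
  pd_sum (fun j _ => (h j).differentiableAt hΩ hx) i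

lemma SmoothUpTo.pd_comm (hf : SmoothUpTo Ω f) (hΩ : IsOpen Ω) (hx : x ∈ Ω) (i j : Fin n) :
    _root_.pd i (_root_.pd j f) x = _root_.pd j (_root_.pd i f) x :=
  _root_.pd_comm ((hf.contDiffAt hΩ hx).of_le (WithTop.coe_le_coe.2 le_top)) i j

namespace IsBoundaryWeight

variable {r : (Fin n → ℝ) → ℝ} {a : ℝ}

lemma wint_add (h : IsBoundaryWeight Ω r) (ha : 0 < a) (hf : SmoothUpTo Ω f)
    (hg : SmoothUpTo Ω g) : wint Ω r a (fun x => f x + g x) = wint Ω r a f + wint Ω r a g := by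
  simp only [wint, mul_add]
  exact integral_add (h.integrableOn_rpow_mul ha hf) (h.integrableOn_rpow_mul ha hg)

lemma wint_nonneg (h : IsBoundaryWeight Ω r) (hg : ∀ x ∈ Ω, 0 ≤ g x) : 0 ≤ wint Ω r a g :=
  setIntegral_nonneg h.isOpen.measurableSet fun x hx =>
    mul_nonneg (Real.rpow_nonneg (h.pos x hx).le _) (hg x hx)

/-- A pointwise inequality up to a multiple of a function with vanishing weighted integral gives
an inequality of weighted integrals. -/
lemma wint_le (h : IsBoundaryWeight Ω r) (ha : 0 < a) {A B G : (Fin n → ℝ) → ℝ} {k C s : ℝ}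
    (hk : 0 < k) (hA : SmoothUpTo Ω A) (hB : SmoothUpTo Ω B) (hG : SmoothUpTo Ω G)
    (hG0 : wint Ω r a G = 0) (hle : ∀ x ∈ Ω, k * A x ≤ C * B x + s * G x) :
    wint Ω r a A ≤ C / k * wint Ω r a B := by
  have hsG : wint Ω r a (fun x => s * G x) = 0 := by
    have : wint Ω r a (fun x => s * G x) = s * wint Ω r a G := by
      simp only [wint, ← integral_const_mul]
      exact integral_congr_ae (ae_of_all _ fun x => by ring)
    rw [this, hG0, mul_zero]
  have hCB : wint Ω r a (fun x => C * B x) = C * wint Ω r a B := by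
    simp only [wint, ← integral_const_mul]
    exact integral_congr_ae (ae_of_all _ fun x => by ring)
  have hkA : wint Ω r a (fun x => k * A x) = k * wint Ω r a A := by
    simp only [wint, ← integral_const_mul]
    exact integral_congr_ae (ae_of_all _ fun x => by ring)
  have hCBs := (SmoothUpTo.const C).mul hB
  have hsGs := (SmoothUpTo.const s).mul hG
  have hmono : wint Ω r a (fun x => k * A x) ≤ wint Ω r a (fun x => C * B x + s * G x) :=
    setIntegral_mono_on (h.integrableOn_rpow_mul ha ((SmoothUpTo.const k).mul hA))
      (h.integrableOn_rpow_mul ha (hCBs.add hsGs)) h.isOpen.measurableSet fun x hx =>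
      mul_le_mul_of_nonneg_left (hle x hx) (Real.rpow_nonneg (h.pos x hx).le _)
  rw [h.wint_add ha hCBs hsGs, hsG, hCB, hkA, add_zero] at hmono
  rw [div_mul_eq_mul_div, le_div_iff₀ hk]
  linarith

lemma smoothUpTo_div (h : IsBoundaryWeight Ω r) {X : Fin n → (Fin n → ℝ) → ℝ}
    (hX : ∀ i, SmoothUpTo Ω (X i)) (b : ℝ) :
    SmoothUpTo Ω (fun x => r x * ∑ i, pd i (X i) x + b * ∑ i, pd i r x * X i x) :=
  (h.smoothUpTo.mul (.sum fun i _ => h.pd_smoothUpTo (hX i) i)).add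
    ((SmoothUpTo.const b).mul (.sum fun i _ => (h.pd_smoothUpTo h.smoothUpTo i).mul (hX i)))

lemma wint_div (h : IsBoundaryWeight Ω r) (ha : 0 < a) {X : Fin n → (Fin n → ℝ) → ℝ}
    (hX : ∀ i, SmoothUpTo Ω (X i)) :
    wint Ω r a (fun x => r x * ∑ i, pd i (X i) x + a * ∑ i, pd i r x * X i x) = 0 := by
  have hr := fun i => h.pd_smoothUpTo h.smoothUpTo i
  have hintegr : ∀ i, IntegrableOn
      (fun x => r x ^ (a - 1) * (r x * pd i (X i) x + a * pd i r x * X i x)) Ω := fun i =>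
    h.integrableOn_rpow_mul ha ((h.smoothUpTo.mul (h.pd_smoothUpTo (hX i) i)).add
      (((SmoothUpTo.const a).mul (hr i)).mul (hX i)))
  have : wint Ω r a (fun x => r x * ∑ i, pd i (X i) x + a * ∑ i, pd i r x * X i x) =
      ∫ x in Ω, ∑ i, r x ^ (a - 1) * (r x * pd i (X i) x + a * pd i r x * X i x) := by
    refine integral_congr_ae (ae_of_all _ fun x => ?_)
    simp only [Finset.mul_sum, ← Finset.sum_add_distrib]
    exact Finset.sum_congr rfl fun i _ => by ring
  rw [this, integral_finsetSum _ fun i _ => hintegr i]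
  exact Finset.sum_eq_zero fun i _ => h.integral_rpow_pd ha (hX i) i

lemma wint_mul_div (h : IsBoundaryWeight Ω r) (ha : 0 < a) {X : Fin n → (Fin n → ℝ) → ℝ}
    (hX : ∀ i, SmoothUpTo Ω (X i)) :
    wint Ω r a (fun x => r x * (r x * ∑ i, pd i (X i) x + (a + 1) * ∑ i, pd i r x * X i x)) =
      0 := by
  rw [← h.wint_div (a := a + 1) (by positivity) hX]
  refine setIntegral_congr_fun h.isOpen.measurableSet fun x hx => ?_
  have : r x ^ (a + 1 - 1) = r x ^ (a - 1) * r x := by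
    rw [← Real.rpow_add_one (h.pos x hx).ne']; ring_nf
  simp only [this]
  ring

end IsBoundaryWeight

/-! ### The degenerate elliptic operator -/

/-- The degenerate operator `H^{ij} (r ∂_i ∂_j f + a (∂_i r) (∂_j f))`. -/
noncomputable def degOp (H : Fin 3 → Fin 3 → (Fin 3 → ℝ) → ℝ) (r : (Fin 3 → ℝ) → ℝ) (a : ℝ)
    (v : (Fin 3 → ℝ) → ℝ) (x : Fin 3 → ℝ) : ℝ :=
  ∑ i, ∑ j, H i j x * (r x * pd i (pd j v) x + a * pd i r x * pd j v x)

/-- A symmetric, uniformly positive definite matrix field, smooth up to the boundary. -/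
structure IsEllipticField (Ω : Set (Fin 3 → ℝ)) (H : Fin 3 → Fin 3 → (Fin 3 → ℝ) → ℝ)
    (θ : ℝ) : Prop where
  smoothUpTo : ∀ i j, SmoothUpTo Ω (H i j)
  symm : ∀ x i j, H i j x = H j i x
  pos : 0 < θ
  coercive : ∀ x ∈ Ω, ∀ p : Fin 3 → ℝ, θ * ∑ j, p j ^ 2 ≤ ∑ i, ∑ j, H i j x * (p i * p j)
  coercive_symm : ∀ x ∈ Ω, ∀ F : Fin 3 → Fin 3 → ℝ, (∀ i j, F i j = F j i) →
    θ * ∑ i, ∑ j, F i j ^ 2 ≤ ∑ i, ∑ j, ∑ k, ∑ l, H i k x * H j l x * (F i j * F k l)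

section Estimates

variable {Ω : Set (Fin 3 → ℝ)} {r : (Fin 3 → ℝ) → ℝ} {a θ : ℝ}
  {H : Fin 3 → Fin 3 → (Fin 3 → ℝ) → ℝ}

lemma SmoothUpTo.degOp {v : (Fin 3 → ℝ) → ℝ} (hv : SmoothUpTo Ω v) (h : IsBoundaryWeight Ω r)
    (hH : IsEllipticField Ω H θ) (a : ℝ) : SmoothUpTo Ω (degOp H r a v) :=
  .sum fun i _ => .sum fun j _ => (hH.smoothUpTo i j).mul
    ((h.smoothUpTo.mul (h.pd_smoothUpTo (h.pd_smoothUpTo hv j) i)).add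
      (((SmoothUpTo.const a).mul (h.pd_smoothUpTo h.smoothUpTo i)).mul (h.pd_smoothUpTo hv j)))

/-- Energy estimate. -/
lemma exists_wint_energy_le (h : IsBoundaryWeight Ω r) (ha : 0 < a)
    (hH : IsEllipticField Ω H θ) :
    ∃ C, ∀ v, SmoothUpTo Ω v →
      wint Ω r a (fun x => r x * ∑ j, pd j v x ^ 2) ≤
        C * wint Ω r a (fun x => degOp H r a v x ^ 2 + v x ^ 2) := by
  obtain ⟨R, hR, hRle⟩ := h.smoothUpTo.exists_bound h.isBounded
  have hBs : ∀ j, SmoothUpTo Ω (fun x => ∑ i, pd i (H i j) x) := fun j =>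
    .sum fun i _ => h.pd_smoothUpTo (hH.smoothUpTo i j) i
  obtain ⟨M, hM, hMle⟩ := (SmoothUpTo.sum (s := Finset.univ) fun j _ =>
    (hBs j).pow 2).exists_bound h.isBounded
  refine ⟨(1 / 2 + R * M / (2 * θ)) / (θ / 2), fun v hv => ?_⟩
  have hp : ∀ j, SmoothUpTo Ω (pd j v) := h.pd_smoothUpTo hv
  have hX₀ : ∀ i j, SmoothUpTo Ω (fun y => H i j y * pd j v y) := fun i j =>
    (hH.smoothUpTo i j).mul (hp j)
  have hX₁ : ∀ i j, SmoothUpTo Ω (fun y => v y * (H i j y * pd j v y)) := fun i j =>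
    hv.mul (hX₀ i j)
  have hX : ∀ i, SmoothUpTo Ω (fun y => ∑ j, v y * (H i j y * pd j v y)) := fun i =>
    .sum fun j _ => hX₁ i j
  refine h.wint_le (s := 1) ha (half_pos hH.pos)
    (h.smoothUpTo.mul (.sum fun j _ => (hp j).pow 2))
    (((hv.degOp h hH a).pow 2).add (hv.pow 2)) (h.smoothUpTo_div hX a) (h.wint_div ha hX)
    fun x hx => ?_
  have hdiv : ∀ i, pd i (fun y => ∑ j, v y * (H i j y * pd j v y)) x =
      ∑ j, (pd i v x * (H i j x * pd j v x) +
        v x * (pd i (H i j) x * pd j v x + H i j x * pd i (pd j v) x)) := fun i => by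
    rw [SmoothUpTo.pd_fun_sum (hX₁ i) h.isOpen hx]
    refine Finset.sum_congr rfl fun j _ => ?_
    rw [hv.pd_fun_mul (hX₀ i j) h.isOpen hx, (hH.smoothUpTo i j).pd_fun_mul (hp j) h.isOpen hx]
  simp only [hdiv]
  rw [energy_identity (fun i j => H i j x) (fun i j => pd i (pd j v) x)
    (fun i j => pd i (H i j) x) (fun j => pd j v x) (fun i => pd i r x) (v x) (r x) a, one_mul]
  exact energy_inequality _ _ θ M R (v x) _ (r x) (fun j => pd j v x)
    (fun j => ∑ i, pd i (H i j) x) rfl hH.pos (h.pos x hx) ((le_abs_self _).trans (hRle x hx))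
    (hH.coercive x hx _) ((le_abs_self _).trans (hMle x hx))

/-- Boundary-weighted gradient estimate, from a Rellich type identity. -/
lemma exists_wint_gradient_le (h : IsBoundaryWeight Ω r) (ha : 0 < a)
    (hH : IsEllipticField Ω H θ) :
    ∃ C, ∀ v, SmoothUpTo Ω v →
      wint Ω r a (fun x => ∑ j, pd j v x ^ 2) ≤
        C * wint Ω r a (fun x => degOp H r a v x ^ 2 + r x * ∑ j, pd j v x ^ 2) := by
  obtain ⟨c, hc, hcle⟩ := h.exists_le
  have hq : ∀ i, SmoothUpTo Ω (pd i r) := h.pd_smoothUpTo h.smoothUpTo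
  set N : Fin 3 → (Fin 3 → ℝ) → ℝ := fun k x => ∑ l, H k l x * pd l r x with hN
  have hNs : ∀ k, SmoothUpTo Ω (N k) := fun k => .sum fun l _ => (hH.smoothUpTo k l).mul (hq l)
  set D : Fin 3 → Fin 3 → Fin 3 → (Fin 3 → ℝ) → ℝ :=
    fun i j k x => H i j x * N k x - 1 / 2 * (H j k x * N i x) with hD
  have hDs : ∀ i j k, SmoothUpTo Ω (D i j k) := fun i j k =>
    ((hH.smoothUpTo i j).mul (hNs k)).sub
      ((SmoothUpTo.const (1 / 2)).mul ((hH.smoothUpTo j k).mul (hNs i)))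
  have hQs : ∀ j k, SmoothUpTo Ω (fun x => ∑ i, pd i (D i j k) x) := fun j k =>
    .sum fun i _ => h.pd_smoothUpTo (hDs i j k) i
  obtain ⟨M₁, hM₁, hM₁le⟩ := (SmoothUpTo.sum (s := Finset.univ) fun k _ =>
    (hNs k).pow 2).exists_bound h.isBounded
  obtain ⟨M₂, hM₂, hM₂le⟩ := (SmoothUpTo.sum (s := Finset.univ) fun j _ =>
    SmoothUpTo.sum (s := Finset.univ) fun k _ => (hQs j k).pow 2).exists_bound h.isBounded
  have hθ := hH.pos
  set δ : ℝ := a / 2 * θ ^ 2 * c / M₁ with hδ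
  have hδ0 : 0 < δ := by positivity
  refine ⟨(a / 2 * θ ^ 2 + (M₂ + 3) + 1 / (2 * δ)) / (a / 4 * θ ^ 2 * c), fun v hv => ?_⟩
  have hp : ∀ j, SmoothUpTo Ω (pd j v) := h.pd_smoothUpTo hv
  have hX₀ : ∀ i j k, SmoothUpTo Ω (fun y => D i j k y * (pd j v y * pd k v y)) := fun i j k =>
    (hDs i j k).mul ((hp j).mul (hp k))
  have hX₁ : ∀ i j, SmoothUpTo Ω (fun y => ∑ k, D i j k y * (pd j v y * pd k v y)) := fun i j =>
    .sum fun k _ => hX₀ i j k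
  have hX : ∀ i, SmoothUpTo Ω (fun y => ∑ j, ∑ k, D i j k y * (pd j v y * pd k v y)) := fun i =>
    .sum fun j _ => hX₁ i j
  refine h.wint_le (s := -1) ha (by positivity) (.sum fun j _ => (hp j).pow 2)
    (((hv.degOp h hH a).pow 2).add (h.smoothUpTo.mul (.sum fun j _ => (hp j).pow 2)))
    (h.smoothUpTo_div hX a) (h.wint_div ha hX) fun x hx => ?_
  have hdiv : ∀ i, pd i (fun y => ∑ j, ∑ k, D i j k y * (pd j v y * pd k v y)) x =
      ∑ j, ∑ k, (pd i (D i j k) x * (pd j v x * pd k v x) +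
        D i j k x * (pd i (pd j v) x * pd k v x + pd j v x * pd i (pd k v) x)) := fun i => by
    rw [SmoothUpTo.pd_fun_sum (hX₁ i) h.isOpen hx]
    refine Finset.sum_congr rfl fun j _ => ?_
    rw [SmoothUpTo.pd_fun_sum (hX₀ i j) h.isOpen hx]
    refine Finset.sum_congr rfl fun k _ => ?_
    rw [(hDs i j k).pd_fun_mul ((hp j).mul (hp k)) h.isOpen hx,
      (hp j).pd_fun_mul (hp k) h.isOpen hx]
  simp only [hdiv]
  have hid := rellich_identity (fun i j => H i j x) (fun i j => pd i (pd j v) x)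
    (hH.symm x) (fun i j => hv.pd_comm h.isOpen hx i j) (fun i j k => pd i (D i j k) x)
    (fun k => N k x) (fun j => pd j v x) (fun i => pd i r x) (fun k => rfl) (r x) a
  rw [show ∀ y, degOp H r a v y = _ from fun _ => rfl, hid]
  have hNq : ∑ k, N k x * pd k r x = ∑ i, ∑ j, H i j x * (pd i r x * pd j r x) := by
    simp only [hN, Finset.sum_mul]
    exact Finset.sum_congr rfl fun i _ => Finset.sum_congr rfl fun j _ => by ring
  have hp0 : 0 ≤ ∑ j, pd j v x ^ 2 := Finset.sum_nonneg fun _ _ => sq_nonneg _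
  refine rellich_inequality a θ c M₁ (M₂ + 3) (r x) _ _ _ _ _ _ (∑ i, pd i r x ^ 2) δ ha hθ hδ0
    (by rw [hδ]; field_simp; exact le_rfl) (h.pos x hx) hp0
    (Finset.sum_nonneg fun _ _ => sq_nonneg _) (hcle x hx)
    (hNq ▸ hH.coercive x hx _) (hH.coercive x hx _) ?_ ?_ (by positivity)
  · refine (Finset.sum_mul_sq_le_sq_mul_sq _ _ _).trans ?_
    exact mul_le_mul_of_nonneg_right ((le_abs_self _).trans (hM₁le x hx)) hp0
  · refine (sum_mul_mul_le _ _).trans (mul_le_mul_of_nonneg_right ?_ hp0)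
    exact add_le_add ((le_abs_self _).trans (hM₂le x hx)) le_rfl

/-- Weighted estimate of the second derivatives. -/
lemma exists_wint_hessian_le (h : IsBoundaryWeight Ω r) (ha : 0 < a)
    (hH : IsEllipticField Ω H θ) :
    ∃ C, ∀ v, SmoothUpTo Ω v →
      wint Ω r a (fun x => r x ^ 2 * ∑ i, ∑ j, pd i (pd j v) x ^ 2) ≤
        C * wint Ω r a (fun x => degOp H r a v x ^ 2 + ∑ j, pd j v x ^ 2) := by
  have hq : ∀ i, SmoothUpTo Ω (pd i r) := h.pd_smoothUpTo h.smoothUpTo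
  set N : Fin 3 → (Fin 3 → ℝ) → ℝ := fun k x => ∑ l, H k l x * pd l r x with hN
  have hNs : ∀ k, SmoothUpTo Ω (N k) := fun k => .sum fun l _ => (hH.smoothUpTo k l).mul (hq l)
  set D : Fin 3 → Fin 3 → Fin 3 → Fin 3 → (Fin 3 → ℝ) → ℝ :=
    fun k i j l x => H i j x * H k l x - H i k x * H j l x with hD
  have hDs : ∀ k i j l, SmoothUpTo Ω (D k i j l) := fun k i j l =>
    ((hH.smoothUpTo i j).mul (hH.smoothUpTo k l)).sub
      ((hH.smoothUpTo i k).mul (hH.smoothUpTo j l))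
  have hAs : ∀ i j l, SmoothUpTo Ω (fun x => ∑ k, (r x * pd k (D k i j l) x +
      (a + 1) * (pd k r x * D k i j l x))) := fun i j l =>
    .sum fun k _ => (h.smoothUpTo.mul (h.pd_smoothUpTo (hDs k i j l) k)).add
      ((SmoothUpTo.const (a + 1)).mul ((hq k).mul (hDs k i j l)))
  obtain ⟨M₁, hM₁, hM₁le⟩ := (SmoothUpTo.sum (s := Finset.univ) fun k _ =>
    (hNs k).pow 2).exists_bound h.isBounded
  obtain ⟨M₃, hM₃, hM₃le⟩ := (SmoothUpTo.sum (s := Finset.univ) fun i _ =>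
    SmoothUpTo.sum (s := Finset.univ) fun j _ => SmoothUpTo.sum (s := Finset.univ) fun l _ =>
      (hAs i j l).pow 2).exists_bound h.isBounded
  have hθ := hH.pos
  refine ⟨(2 + 2 * a ^ 2 * M₁ + 3 * M₃ / (2 * θ)) / (θ / 2), fun v hv => ?_⟩
  have hp : ∀ j, SmoothUpTo Ω (pd j v) := h.pd_smoothUpTo hv
  have hF : ∀ i j, SmoothUpTo Ω (pd i (pd j v)) := fun i j => h.pd_smoothUpTo (hp j) i
  have hX₀ : ∀ k i j l, SmoothUpTo Ω (fun y => D k i j l y * (pd i (pd j v) y * pd l v y)) :=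
    fun k i j l => (hDs k i j l).mul ((hF i j).mul (hp l))
  have hX₁ : ∀ k i j, SmoothUpTo Ω
      (fun y => ∑ l, D k i j l y * (pd i (pd j v) y * pd l v y)) :=
    fun k i j => .sum fun l _ => hX₀ k i j l
  have hX₂ : ∀ k i, SmoothUpTo Ω
      (fun y => ∑ j, ∑ l, D k i j l y * (pd i (pd j v) y * pd l v y)) :=
    fun k i => .sum fun j _ => hX₁ k i j
  have hX : ∀ k, SmoothUpTo Ω
      (fun y => ∑ i, ∑ j, ∑ l, D k i j l y * (pd i (pd j v) y * pd l v y)) :=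
    fun k => .sum fun i _ => hX₂ k i
  refine h.wint_le (s := -1) ha (half_pos hθ)
    ((h.smoothUpTo.pow 2).mul (.sum fun i _ => .sum fun j _ => (hF i j).pow 2))
    (((hv.degOp h hH a).pow 2).add (.sum fun j _ => (hp j).pow 2))
    (h.smoothUpTo.mul (h.smoothUpTo_div hX (a + 1))) (h.wint_mul_div ha hX) fun x hx => ?_
  have hdiv : ∀ k, pd k (fun y => ∑ i, ∑ j, ∑ l, D k i j l y * (pd i (pd j v) y * pd l v y)) x =
      ∑ i, ∑ j, ∑ l, (pd k (D k i j l) x * (pd i (pd j v) x * pd l v x) +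
        D k i j l x * (pd k (pd i (pd j v)) x * pd l v x +
          pd i (pd j v) x * pd k (pd l v) x)) := fun k => by
    rw [SmoothUpTo.pd_fun_sum (hX₂ k) h.isOpen hx]
    refine Finset.sum_congr rfl fun i _ => ?_
    rw [SmoothUpTo.pd_fun_sum (hX₁ k i) h.isOpen hx]
    refine Finset.sum_congr rfl fun j _ => ?_
    rw [SmoothUpTo.pd_fun_sum (hX₀ k i j) h.isOpen hx]
    refine Finset.sum_congr rfl fun l _ => ?_
    rw [(hDs k i j l).pd_fun_mul ((hF i j).mul (hp l)) h.isOpen hx,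
      (hF i j).pd_fun_mul (hp l) h.isOpen hx]
  simp only [hdiv]
  have hcomm : ∀ i j, EqOn (pd i (pd j v)) (pd j (pd i v)) Ω := fun i j y hy =>
    hv.pd_comm h.isOpen hy i j
  have hT : ∀ i j k, pd k (pd i (pd j v)) x = pd j (pd i (pd k v)) x := fun i j k => by
    rw [pd_congr_of_eqOn h.isOpen (hcomm i j) k hx, (hp i).pd_comm h.isOpen hx k j,
      pd_congr_of_eqOn h.isOpen (hcomm k i) j hx]
  have hid := hessian_identity (fun i j => H i j x) (fun i j => pd i (pd j v) x)
    (fun k i j l => pd k (D k i j l) x) (fun k i j => pd k (pd i (pd j v)) x) hT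
    (fun j => pd j v x) (fun i => pd i r x) (r x) (a + 1)
  rw [hid]
  have hp0 : 0 ≤ ∑ j, pd j v x ^ 2 := Finset.sum_nonneg fun _ _ => sq_nonneg _
  refine hessian_inequality θ M₁ M₃ a (r x) _ _ (∑ k, N k x * pd k v x) _ _ _ _ _ _ rfl rfl hθ
    (hH.coercive_symm x hx _ fun i j => hcomm i j hx) ?_ ?_ hM₁.le
    ((le_abs_self _).trans (hM₃le x hx))
  · have e : ∑ k, N k x * pd k v x = ∑ i, ∑ j, H i j x * (pd i r x * pd j v x) := by
      rw [Finset.sum_comm]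
      refine Finset.sum_congr rfl fun j _ => ?_
      simp only [hN, Finset.sum_mul]
      exact Finset.sum_congr rfl fun i _ => by rw [hH.symm x i j]; ring
    rw [e]
    simp only [_root_.degOp, Finset.mul_sum, ← Finset.sum_add_distrib]
    exact Finset.sum_congr rfl fun i _ => Finset.sum_congr rfl fun j _ => by ring
  · refine (Finset.sum_mul_sq_le_sq_mul_sq _ _ _).trans ?_
    exact mul_le_mul_of_nonneg_right ((le_abs_self _).trans (hM₁le x hx)) hp0

end Estimates

/-! ### The coefficients of the relativistic operator -/

lemma mul_sum_sq_le_sum_sub_mul (v p : Fin 3 → ℝ) :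
    (1 - ∑ i, v i ^ 2) * ∑ j, p j ^ 2 ≤
      ∑ i, ∑ j, ((if i = j then (1 : ℝ) else 0) - v i * v j) * (p i * p j) := by
  have : ∑ i, ∑ j, ((if i = j then (1 : ℝ) else 0) - v i * v j) * (p i * p j) =
      ∑ j, p j ^ 2 - (∑ i, v i * p i) ^ 2 := by
    simp [Fin.sum_univ_three]
    ring
  rw [this]
  have := Finset.sum_mul_sq_le_sq_mul_sq Finset.univ v p
  linarith

lemma sq_mul_sum_sq_le_sum_sub_mul (v : Fin 3 → ℝ) (hv : 0 ≤ 1 - ∑ i, v i ^ 2)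
    (F : Fin 3 → Fin 3 → ℝ) :
    (1 - ∑ i, v i ^ 2) ^ 2 * ∑ i, ∑ j, F i j ^ 2 ≤
      ∑ i, ∑ j, ∑ k, ∑ l, ((if i = k then (1 : ℝ) else 0) - v i * v k) *
        ((if j = l then (1 : ℝ) else 0) - v j * v l) * (F i j * F k l) := by
  set Q : (Fin 3 → ℝ) → ℝ := fun p =>
    ∑ i, ∑ j, ((if i = j then (1 : ℝ) else 0) - v i * v j) * (p i * p j) with hQ
  have hQle : ∀ p, (1 - ∑ i, v i ^ 2) * ∑ j, p j ^ 2 ≤ Q p := mul_sum_sq_le_sum_sub_mul v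
  have hQ0 : ∀ p, 0 ≤ Q p := fun p =>
    (mul_nonneg hv (Finset.sum_nonneg fun _ _ => sq_nonneg _)).trans (hQle p)
  have key : ∑ i, ∑ j, ∑ k, ∑ l, ((if i = k then (1 : ℝ) else 0) - v i * v k) *
        ((if j = l then (1 : ℝ) else 0) - v j * v l) * (F i j * F k l) =
      (1 - ∑ i, v i ^ 2) * ∑ j, Q (fun i => F i j) + (Q (fun i => F i 1 * v 2 - F i 2 * v 1) +
        Q (fun i => F i 2 * v 0 - F i 0 * v 2) + Q (fun i => F i 0 * v 1 - F i 1 * v 0)) := by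
    simp [hQ, Fin.sum_univ_three]
    ring
  rw [key]
  have h1 : (1 - ∑ i, v i ^ 2) * ∑ i, ∑ j, F i j ^ 2 ≤ ∑ j, Q (fun i => F i j) := by
    rw [Finset.sum_comm, Finset.mul_sum]
    exact Finset.sum_le_sum fun j _ => hQle _
  have h2 := mul_le_mul_of_nonneg_left h1 hv
  have h3 := hQ0 (fun i => F i 1 * v 2 - F i 2 * v 1)
  have h4 := hQ0 (fun i => F i 2 * v 0 - F i 0 * v 2)
  have h5 := hQ0 (fun i => F i 0 * v 1 - F i 1 * v 0)
  linarith [sq (1 - ∑ i, v i ^ 2), mul_assoc (1 - ∑ i, v i ^ 2) (1 - ∑ i, v i ^ 2)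
    (∑ i, ∑ j, F i j ^ 2), congrArg (· * ∑ i, ∑ j, F i j ^ 2) (sq (1 - ∑ i, v i ^ 2))]

lemma exists_isEllipticField_Hcoef {Ω : Set (Fin 3 → ℝ)} {u : (Fin 3 → ℝ) → Fin 4 → ℝ}
    (hb : Bornology.IsBounded Ω) (hu : ∀ α, ContDiffOn ℝ (⊤ : ℕ∞) (fun x => u x α) (closure Ω))
    (hu0 : ∀ x ∈ closure Ω, 0 < u x 0)
    (hunorm : ∀ x ∈ closure Ω,
      -(u x 0) ^ 2 + (u x 1) ^ 2 + (u x 2) ^ 2 + (u x 3) ^ 2 = -1) :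
    ∃ θ, IsEllipticField Ω (Hcoef u) θ := by
  obtain ⟨U, hU, hUle⟩ := (hu 0).smoothUpTo.exists_bound hb
  have hH : ∀ x i j, Hcoef u i j x = (if i = j then (1 : ℝ) else 0) -
      u x i.succ / u x 0 * (u x j.succ / u x 0) := fun x i j => by
    rw [Hcoef, div_mul_div_comm, sq]
  have hv : ∀ x ∈ Ω, 1 - ∑ i : Fin 3, (u x i.succ / u x 0) ^ 2 = 1 / u x 0 ^ 2 := fun x hx => by
    have h0 := (hu0 x (subset_closure hx)).ne'
    have h1 := hunorm x (subset_closure hx)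
    rw [Fin.sum_univ_three]
    simp only [Fin.succ_zero_eq_one, Fin.succ_one_eq_two, show (2 : Fin 3).succ = 3 from rfl]
    field_simp
    linarith
  have hle : ∀ x ∈ Ω, 1 / U ^ 2 ≤ 1 / u x 0 ^ 2 := fun x hx => by
    have h0 := hu0 x (subset_closure hx)
    exact one_div_le_one_div_of_le (by positivity)
      (pow_le_pow_left₀ h0.le ((le_abs_self _).trans (hUle x hx)) 2)
  refine ⟨min (1 / U ^ 2) ((1 / U ^ 2) ^ 2), fun i j => ?_, fun x i j => ?_, by positivity,
    fun x hx p => ?_, fun x hx F _ => ?_⟩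
  · exact (contDiffOn_const.sub (((hu i.succ).mul (hu j.succ)).div ((hu 0).pow 2)
      fun x hx => pow_ne_zero 2 (hu0 x hx).ne')).smoothUpTo
  · simp only [Hcoef, eq_comm, mul_comm]
  · simp only [hH]
    refine le_trans ?_ (mul_sum_sq_le_sum_sub_mul (fun i => u x i.succ / u x 0) p)
    rw [hv x hx]
    exact mul_le_mul_of_nonneg_right ((min_le_left _ _).trans (hle x hx))
      (Finset.sum_nonneg fun _ _ => sq_nonneg _)
  · simp only [hH]
    refine le_trans ?_ (sq_mul_sum_sq_le_sum_sub_mul (fun i => u x i.succ / u x 0)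
      (by rw [hv x hx]; positivity) F)
    rw [hv x hx]
    exact mul_le_mul_of_nonneg_right ((min_le_right _ _).trans
      (pow_le_pow_left₀ (by positivity) (hle x hx) 2))
      (Finset.sum_nonneg fun _ _ => Finset.sum_nonneg fun _ _ => sq_nonneg _)

section Combination

variable {Ω : Set (Fin 3 → ℝ)} {r : (Fin 3 → ℝ) → ℝ} {a θ : ℝ}
  {H : Fin 3 → Fin 3 → (Fin 3 → ℝ) → ℝ}

lemma IsBoundaryWeight.wint_mono (h : IsBoundaryWeight Ω r) (ha : 0 < a)
    {A B : (Fin 3 → ℝ) → ℝ} (hA : SmoothUpTo Ω A) (hB : SmoothUpTo Ω B) {C : ℝ}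
    (hle : ∀ x ∈ Ω, A x ≤ C * B x) : wint Ω r a A ≤ C * wint Ω r a B := by
  have := h.wint_le (k := 1) (C := C) (s := 0) ha one_pos hA hB (.const 0) (by simp [wint])
    (by simpa using hle)
  simpa using this

/-- All weighted derivatives up to order two are controlled by the operator and the function. -/
lemma exists_wint_derivatives_le (h : IsBoundaryWeight Ω r) (ha : 0 < a)
    (hH : IsEllipticField Ω H θ) :
    ∃ C, 0 ≤ C ∧ ∀ v, SmoothUpTo Ω v →
      let J := wint Ω r a (fun x => degOp H r a v x ^ 2) + wint Ω r a (fun x => v x ^ 2)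
      wint Ω r a (fun x => r x ^ 2 * v x ^ 2) ≤ C * J ∧
      (∀ i, wint Ω r a (fun x => r x ^ 2 * pd i v x ^ 2) ≤ C * J) ∧
      ∀ i j, wint Ω r a (fun x => r x ^ 2 * pd i (pd j v) x ^ 2) ≤ C * J := by
  obtain ⟨R, hR, hRle⟩ := h.smoothUpTo.exists_bound h.isBounded
  obtain ⟨C₁, h₁⟩ := exists_wint_energy_le h ha hH
  obtain ⟨C₂, h₂⟩ := exists_wint_gradient_le h ha hH
  obtain ⟨C₃, h₃⟩ := exists_wint_hessian_le h ha hH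
  set K₁ := max C₁ 0
  set K₂ := max C₂ 0 * (1 + K₁)
  set K₃ := max C₃ 0 * (1 + K₂)
  have hK₁ : 0 ≤ K₁ := le_max_right _ _
  have hK₂ : 0 ≤ K₂ := mul_nonneg (le_max_right _ _) (by positivity)
  have hK₃ : 0 ≤ K₃ := mul_nonneg (le_max_right _ _) (by positivity)
  refine ⟨R ^ 2 + R ^ 2 * K₂ + K₃, by positivity, fun v hv => ?_⟩
  intro J
  have hp : ∀ j, SmoothUpTo Ω (pd j v) := h.pd_smoothUpTo hv
  have hF : ∀ i j, SmoothUpTo Ω (pd i (pd j v)) := fun i j => h.pd_smoothUpTo (hp j) i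
  have hL := (hv.degOp h hH a).pow 2
  have hP : SmoothUpTo Ω (fun x => ∑ j, pd j v x ^ 2) := .sum fun j _ => (hp j).pow 2
  have hr2 := h.smoothUpTo.pow 2
  have hL0 : 0 ≤ wint Ω r a (fun x => degOp H r a v x ^ 2) := h.wint_nonneg fun _ _ => sq_nonneg _
  have hv0 : 0 ≤ wint Ω r a (fun x => v x ^ 2) := h.wint_nonneg fun _ _ => sq_nonneg _
  have hJ : 0 ≤ J := add_nonneg hL0 hv0
  have hrsq : ∀ x ∈ Ω, r x ^ 2 ≤ R ^ 2 := fun x hx =>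
    pow_le_pow_left₀ (h.pos x hx).le ((le_abs_self _).trans (hRle x hx)) 2
  have e₁ : wint Ω r a (fun x => r x * ∑ j, pd j v x ^ 2) ≤ K₁ * J := by
    refine (h₁ v hv).trans ?_
    rw [h.wint_add ha hL (hv.pow 2)]
    exact mul_le_mul_of_nonneg_right (le_max_left _ _) hJ
  have e₂ : wint Ω r a (fun x => ∑ j, pd j v x ^ 2) ≤ K₂ * J := by
    refine (h₂ v hv).trans ?_
    rw [h.wint_add ha hL (h.smoothUpTo.mul hP)]
    have h0 : 0 ≤ wint Ω r a (fun x => r x * ∑ j, pd j v x ^ 2) := h.wint_nonneg fun x hx =>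
      mul_nonneg (h.pos x hx).le (Finset.sum_nonneg fun _ _ => sq_nonneg _)
    refine (mul_le_mul_of_nonneg_right (le_max_left C₂ 0) (add_nonneg hL0 h0)).trans ?_
    rw [mul_assoc]
    exact mul_le_mul_of_nonneg_left (by linarith) (le_max_right _ _)
  have e₃ : wint Ω r a (fun x => r x ^ 2 * ∑ i, ∑ j, pd i (pd j v) x ^ 2) ≤ K₃ * J := by
    refine (h₃ v hv).trans ?_
    rw [h.wint_add ha hL hP]
    have h0 : 0 ≤ wint Ω r a (fun x => ∑ j, pd j v x ^ 2) := h.wint_nonneg fun x hx =>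
      Finset.sum_nonneg fun _ _ => sq_nonneg _
    refine (mul_le_mul_of_nonneg_right (le_max_left C₃ 0) (add_nonneg hL0 h0)).trans ?_
    rw [mul_assoc]
    exact mul_le_mul_of_nonneg_left (by linarith) (le_max_right _ _)
  have s₁ : 0 ≤ R ^ 2 * J := by positivity
  have s₂ : 0 ≤ R ^ 2 * (K₂ * J) := by positivity
  have s₃ : 0 ≤ K₃ * J := by positivity
  refine ⟨?_, fun i => ?_, fun i j => ?_⟩
  · have := h.wint_mono ha (hr2.mul (hv.pow 2)) (hv.pow 2) (C := R ^ 2) fun x hx =>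
      mul_le_mul_of_nonneg_right (hrsq x hx) (sq_nonneg _)
    nlinarith [sq_nonneg R]
  · have := h.wint_mono ha (hr2.mul ((hp i).pow 2)) hP (C := R ^ 2) fun x hx =>
      mul_le_mul (hrsq x hx)
        (Finset.single_le_sum (f := fun j => pd j v x ^ 2) (fun _ _ => sq_nonneg _)
          (Finset.mem_univ i)) (sq_nonneg _) (sq_nonneg _)
    nlinarith [sq_nonneg R]
  · have := h.wint_mono ha (hr2.mul ((hF i j).pow 2))
      (hr2.mul (.sum fun i _ => .sum fun j _ => (hF i j).pow 2)) (C := 1) fun x hx => by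
        rw [one_mul]
        refine mul_le_mul_of_nonneg_left ?_ (sq_nonneg _)
        exact (Finset.single_le_sum (f := fun j => pd i (pd j v) x ^ 2) (fun _ _ => sq_nonneg _)
          (Finset.mem_univ j)).trans (Finset.single_le_sum
            (f := fun i => ∑ j, pd i (pd j v) x ^ 2)
            (fun _ _ => Finset.sum_nonneg fun _ _ => sq_nonneg _) (Finset.mem_univ i))
    nlinarith [sq_nonneg R]

/-! ### The weighted Sobolev norms -/

variable {κ : ℝ} {f : (Fin 3 → ℝ) → ℝ}

lemma rSobNorm_zero_sq (h : IsBoundaryWeight Ω r) :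
    rSobNorm Ω r 0 (1 / (2 * κ) - 1 / 2) f ^ 2 = wint Ω r (1 / κ) (fun x => f x ^ 2) := by
  have hσ : 2 * (1 / (2 * κ) - 1 / 2) = 1 / κ - 1 := by ring
  rw [rSobNorm, Real.sq_sqrt]
  · simp only [hσ]
    simp [wint, mderiv]
  · exact Finset.sum_nonneg fun _ _ => Finset.sum_nonneg fun _ _ =>
      setIntegral_nonneg h.isOpen.measurableSet fun x hx =>
        mul_nonneg (Real.rpow_nonneg (h.pos x hx).le _) (sq_nonneg _)

lemma IsBoundaryWeight.setIntegral_rpow_mul_eq_wint (h : IsBoundaryWeight Ω r)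
    (g : (Fin 3 → ℝ) → ℝ) :
    ∫ x in Ω, r x ^ (2 * (1 / (2 * κ) + 1 / 2)) * g x =
      wint Ω r (1 / κ) (fun x => r x ^ 2 * g x) := by
  refine setIntegral_congr_fun h.isOpen.measurableSet fun x hx => ?_
  have hσ : 2 * (1 / (2 * κ) + 1 / 2) = 1 / κ - 1 + (2 : ℕ) := by push_cast; ring
  simp only [hσ, Real.rpow_add_natCast (h.pos x hx).ne', mul_assoc]

lemma rSobNorm_two_le (h : IsBoundaryWeight Ω r) {K : ℝ}
    (h₀ : wint Ω r (1 / κ) (fun x => r x ^ 2 * f x ^ 2) ≤ K)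
    (h₁ : ∀ i, wint Ω r (1 / κ) (fun x => r x ^ 2 * pd i f x ^ 2) ≤ K)
    (h₂ : ∀ i j, wint Ω r (1 / κ) (fun x => r x ^ 2 * pd i (pd j f) x ^ 2) ≤ K) :
    rSobNorm Ω r 2 (1 / (2 * κ) + 1 / 2) f ≤ √(13 * K) := by
  refine Real.sqrt_le_sqrt ?_
  simp only [h.setIntegral_rpow_mul_eq_wint]
  rw [Finset.sum_range_succ, Finset.sum_range_succ, Finset.sum_range_one]
  have s₀ : ∑ β : Fin 0 → Fin 3, wint Ω r (1 / κ) (fun x => r x ^ 2 * mderiv β f x ^ 2) ≤ K :=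
    by simpa [mderiv] using h₀
  have s₁ : ∑ β : Fin 1 → Fin 3, wint Ω r (1 / κ) (fun x => r x ^ 2 * mderiv β f x ^ 2) ≤
      3 * K := by
    refine (Finset.sum_le_card_nsmul _ _ K fun β _ => ?_).trans_eq (by simp)
    simpa [mderiv] using h₁ (β 0)
  have s₂ : ∑ β : Fin 2 → Fin 3, wint Ω r (1 / κ) (fun x => r x ^ 2 * mderiv β f x ^ 2) ≤
      9 * K := by
    refine (Finset.sum_le_card_nsmul _ _ K fun β _ => ?_).trans_eq (by norm_num)
    simpa [mderiv] using h₂ (β 0) (β 1)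
  linarith

end Combination

end Helpers

/-- **Basic weighted elliptic estimate for `L̃₁`** (part of Lemma 3.8 of the paper):
`‖f‖_{H^{2,1/(2κ)+1/2}} ≲ ‖L̃₁ f‖_{H^{0,1/(2κ)-1/2}} + ‖f‖_{H^{0,1/(2κ)-1/2}}`. -/
theorem elliptic_estimate_L1 (Ω : Set (Fin 3 → ℝ))
    (hΩo : IsOpen Ω) (hΩb : Bornology.IsBounded Ω) (hΩs : HasSmoothBoundary Ω)
    (κ : ℝ) (hκ : 0 < κ)
    (r : (Fin 3 → ℝ) → ℝ) (hr : ContDiffOn ℝ (⊤ : ℕ∞) r (closure Ω))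
    (hrpos : ∀ x ∈ Ω, 0 < r x) (hr0 : ∀ x ∈ frontier Ω, r x = 0)
    (hrgrad : ∀ x ∈ frontier Ω, fderiv ℝ r x ≠ 0)
    (u : (Fin 3 → ℝ) → Fin 4 → ℝ)
    (hu : ∀ α, ContDiffOn ℝ (⊤ : ℕ∞) (fun x => u x α) (closure Ω))
    (hu0 : ∀ x ∈ closure Ω, 0 < u x 0)
    (hunorm : ∀ x ∈ closure Ω,
      -(u x 0) ^ 2 + (u x 1) ^ 2 + (u x 2) ^ 2 + (u x 3) ^ 2 = -1) :
    ∃ C > 0, ∀ f : (Fin 3 → ℝ) → ℝ, ContDiffOn ℝ (⊤ : ℕ∞) f (closure Ω) →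
      rSobNorm Ω r 2 (1/(2*κ) + 1/2) f
        ≤ C * (rSobNorm Ω r 0 (1/(2*κ) - 1/2) (L1t κ r u f)
            + rSobNorm Ω r 0 (1/(2*κ) - 1/2) f) := by
  have h := isBoundaryWeight_of_fderiv_ne_zero hΩo hΩb (hΩs.uniqueDiffOn_closure hΩo) hr hrpos
    hr0 hrgrad
  have ha : 0 < 1 / κ := by positivity
  obtain ⟨θ, hH⟩ := exists_isEllipticField_Hcoef hΩb hu hu0 hunorm
  obtain ⟨C, hC, hCle⟩ := exists_wint_derivatives_le h ha hH
  refine ⟨√(13 * C) + 1, by positivity, fun f hf => ?_⟩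
  have hfs := hf.smoothUpTo
  obtain ⟨h₀, h₁, h₂⟩ := hCle f hfs
  refine (rSobNorm_two_le h h₀ h₁ h₂).trans ?_
  have hL : wint Ω r (1 / κ) (fun x => degOp (Hcoef u) r (1 / κ) f x ^ 2) ≤
      wint Ω r (1 / κ) (fun x => L1t κ r u f x ^ 2) := by
    have hs := hfs.degOp h hH (1 / κ)
    refine (h.wint_mono ha (hs.pow 2) (((SmoothUpTo.const (κ + 1)).mul hs).pow 2) (C := 1)
      fun x _ => ?_).trans_eq (one_mul _)
    rw [one_mul, mul_pow]
    exact le_mul_of_one_le_left (sq_nonneg _) (one_le_pow₀ (by linarith))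
  rw [← rSobNorm_zero_sq h (f := L1t κ r u f)] at hL
  rw [← rSobNorm_zero_sq h (f := f)]
  have hA : 0 ≤ rSobNorm Ω r 0 (1 / (2 * κ) - 1 / 2) (L1t κ r u f) := Real.sqrt_nonneg _
  have hB : 0 ≤ rSobNorm Ω r 0 (1 / (2 * κ) - 1 / 2) f := Real.sqrt_nonneg _
  set A := rSobNorm Ω r 0 (1 / (2 * κ) - 1 / 2) (L1t κ r u f)
  set B := rSobNorm Ω r 0 (1 / (2 * κ) - 1 / 2) f
  rw [← mul_assoc, Real.sqrt_mul (by positivity)]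
  refine mul_le_mul (by linarith) (Real.sqrt_le_iff.2 ⟨by positivity, ?_⟩) (Real.sqrt_nonneg _)
    (by positivity)
  nlinarith [mul_nonneg hA hB]
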